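/- Let G be a planar triangle-free graph and F a face of a planar embedding of G whose boundary cycle has length at most 5. Then every proper 3-coloring of the boundary cycle of F extends to a proper 3-coloring of G. -/

import Mathlib

universe u
variable {V : Type u}



/-- A topological embedding (drawing) of a simple graph in a topological space `X`:
vertices map to distinct points, edges map to arcs meeting only at common endpoints. -/
structure GraphEmbeddingIn (X : Type*) [TopologicalSpace X] (G : SimpleGraph V) where
  vertexPos : V → X
  vertexInj : Function.Injective vertexPos
  edgeArc : ∀ u v : V, G.Adj u v → ℝ → X
  arc_cont : ∀ u v h, ContinuousOn (edgeArc u v h) (Set.Icc 0 1)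
  arc_injOn : ∀ u v h, Set.InjOn (edgeArc u v h) (Set.Icc 0 1)
  arc_start : ∀ u v h, edgeArc u v h 0 = vertexPos u
  arc_end : ∀ u v h, edgeArc u v h 1 = vertexPos v
  arc_avoid : ∀ u v h (w : V), vertexPos w ∉ edgeArc u v h '' Set.Ioo 0 1
  arc_disjoint : ∀ u v h u' v' h', s(u, v) ≠ s(u', v') →
    edgeArc u v h '' Set.Ioo 0 1 ∩ edgeArc u' v' h' '' Set.Icc 0 1 = ∅

/-- A graph is planar if it has a drawing in the plane. -/
def SimpleGraph.IsPlanar (G : SimpleGraph V) : Prop :=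
  Nonempty (GraphEmbeddingIn (ℝ × ℝ) G)


variable {X : Type*} [TopologicalSpace X] {G : SimpleGraph V}

/-- The point set of the drawing. -/
def GraphEmbeddingIn.drawing (E : GraphEmbeddingIn X G) : Set X :=
  Set.range E.vertexPos ∪ ⋃ (u) (v) (h : G.Adj u v), E.edgeArc u v h '' Set.Icc 0 1

/-- The point set of the drawing of a closed walk. -/
def GraphEmbeddingIn.walkDrawing (E : GraphEmbeddingIn X G) {v : V} (W : G.Walk v v) : Set X :=
  ⋃ d ∈ W.darts, E.edgeArc d.toProd.1 d.toProd.2 d.adj '' Set.Icc 0 1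

/-- A face of the drawing: a connected component of the complement of the drawing. -/
def GraphEmbeddingIn.IsFace (E : GraphEmbeddingIn X G) (F : Set X) : Prop :=
  ∃ x ∈ E.drawingᶜ, F = connectedComponentIn E.drawingᶜ x


namespace ThreeColoring

open Finset
open scoped Classical

noncomputable def edgeInd {α : Type u} (G : SimpleGraph α) (a b : α) : ℤ :=
  if G.Adj a b then 1 else 0

noncomputable def cut {α : Type u} (G : SimpleGraph α) (A B : Finset α) : ℤ :=
  ∑ a ∈ A, ∑ b ∈ B, edgeInd G a b

noncomputable def potential {α : Type u} (G : SimpleGraph α) (A : Finset α) : ℤ :=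
  10 * #A - 3 * cut G A A

def ColorableOn {α : Type u} (G : SimpleGraph α) (A : Finset α) : Prop :=
  ∃ φ : α → Fin 3, ∀ a ∈ A, ∀ b ∈ A, G.Adj a b → φ a ≠ φ b

section basics

variable {α : Type u} (G : SimpleGraph α)

lemma edgeInd_nonneg (a b : α) : 0 ≤ edgeInd G a b := by
  unfold edgeInd; split_ifs <;> simp

lemma edgeInd_le_one (a b : α) : edgeInd G a b ≤ 1 := by
  unfold edgeInd; split_ifs <;> simp

lemma edgeInd_comm (a b : α) : edgeInd G a b = edgeInd G b a := by
  simp [edgeInd, G.adj_comm]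

lemma edgeInd_self (a : α) : edgeInd G a a = 0 := by
  simp [edgeInd]

lemma edgeInd_of_adj {G : SimpleGraph α} {a b : α} (h : G.Adj a b) : edgeInd G a b = 1 := by
  simp [edgeInd, h]

lemma cut_comm (A B : Finset α) : cut G A B = cut G B A := by
  unfold cut
  rw [sum_comm]
  simp_rw [edgeInd_comm G]

lemma cut_union_left {A B : Finset α} (h : Disjoint A B) (C : Finset α) :
    cut G (A ∪ B) C = cut G A C + cut G B C :=
  sum_union h

lemma cut_union_right {A B : Finset α} (h : Disjoint A B) (C : Finset α) :
    cut G C (A ∪ B) = cut G C A + cut G C B := by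
  rw [cut_comm, cut_union_left G h, cut_comm G A, cut_comm G B]

lemma cut_singleton_left (a : α) (B : Finset α) : cut G {a} B = ∑ b ∈ B, edgeInd G a b := by
  simp [cut]

lemma potential_union {A B : Finset α} (h : Disjoint A B) :
    potential G (A ∪ B) = potential G A + potential G B - 6 * cut G A B := by
  unfold potential
  rw [cut_union_left G h, cut_union_right G h, cut_union_right G h, card_union_of_disjoint h,
    cut_comm G B A]
  push_cast; ring

lemma potential_insert {a : α} {A : Finset α} (h : a ∉ A) :
    potential G (insert a A) = potential G A + 10 - 6 * ∑ b ∈ A, edgeInd G a b := by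
  rw [insert_eq, potential_union G (by simpa using h), cut_singleton_left]
  simp [potential, cut, edgeInd_self]
  ring

lemma ColorableOn.mono {G : SimpleGraph α} {A B : Finset α} (h : ColorableOn G B) (hAB : A ⊆ B) :
    ColorableOn G A := by
  obtain ⟨φ, hφ⟩ := h
  exact ⟨φ, fun a ha b hb => hφ a (hAB ha) b (hAB hb)⟩

lemma four_le_card_of_not_colorableOn {G : SimpleGraph α} {A : Finset α}
    (h : ¬ ColorableOn G A) : 4 ≤ #A := by
  by_contra! hc
  apply h
  have : Fintype.card A ≤ Fintype.card (Fin 3) := by simp; omega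
  obtain ⟨f⟩ := Function.Embedding.nonempty_of_card_le this
  refine ⟨fun a => if ha : a ∈ A then f ⟨a, ha⟩ else 0, fun a ha b hb hab => ?_⟩
  simp only [ha, hb, dif_pos]
  intro h
  have := f.injective h
  simp only [Subtype.mk.injEq] at this
  exact hab.ne this

end basics

section collapse

variable {α : Type u}

/-- Replace the vertex set `R`, coloured by `φ`, by a triangle whose vertices stand for the
colour classes. -/
def collapse (G : SimpleGraph α) (R : Finset α) (φ : α → Fin 3) : SimpleGraph (α ⊕ Fin 3) where
  Adj x y := match x, y with
    | .inl a, .inl b => G.Adj a b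
    | .inl a, .inr i => ∃ r ∈ R, φ r = i ∧ G.Adj a r
    | .inr i, .inl a => ∃ r ∈ R, φ r = i ∧ G.Adj a r
    | .inr i, .inr j => i ≠ j
  symm := by
    constructor
    rintro (a | i) (b | j) h
    · exact G.adj_symm h
    · exact h
    · exact h
    · exact Ne.symm h
  loopless := by
    constructor
    rintro (a | i) h
    · exact G.loopless.irrefl a h
    · exact h rfl

lemma not_colorableOn_collapse {G : SimpleGraph α} {A R : Finset α} {φ : α → Fin 3}
    (hφ : ∀ a ∈ R, ∀ b ∈ R, G.Adj a b → φ a ≠ φ b) (hA : ¬ ColorableOn G A) :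
    ¬ ColorableOn (collapse G R φ) ((A \ R).disjSum univ) := by
  rintro ⟨ψ, hψ⟩
  apply hA
  have hinj : Function.Injective fun i => ψ (.inr i) := by
    intro i j hij
    by_contra hne
    exact hψ (.inr i) (by simp) (.inr j) (by simp) hne hij
  refine ⟨fun a => if a ∈ R then ψ (.inr (φ a)) else ψ (.inl a), fun a ha b hb hab => ?_⟩
  by_cases haR : a ∈ R <;> by_cases hbR : b ∈ R <;> simp only [haR, hbR, if_true, if_false]
  · exact fun h => hφ a haR b hbR hab (hinj h)
  · exact hψ _ (by simp) _ (by simp [hb, hbR]) ⟨a, haR, rfl, hab.symm⟩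
  · exact hψ _ (by simp [ha, haR]) _ (by simp) ⟨b, hbR, rfl, hab⟩
  · exact hψ _ (by simp [ha, haR]) _ (by simp [hb, hbR]) hab

lemma cut_collapse_le (G : SimpleGraph α) (R : Finset α) (φ : α → Fin 3) (a : α)
    (J : Finset (Fin 3)) :
    ∑ j ∈ J, edgeInd (collapse G R φ) (.inl a) (.inr j) ≤
      ∑ r ∈ R with φ r ∈ J, edgeInd G a r := by
  rw [← sum_fiberwise_of_maps_to (s := R.filter (φ · ∈ J)) (t := J) (g := φ) (by simp)]
  refine sum_le_sum fun j hj => ?_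
  by_cases h : (collapse G R φ).Adj (.inl a) (.inr j)
  · obtain ⟨r, hr, rfl, har⟩ := h
    calc _ ≤ 1 := edgeInd_le_one _ _ _
      _ = edgeInd G a r := (edgeInd_of_adj har).symm
      _ ≤ _ := single_le_sum (f := fun r => edgeInd G a r) (fun _ _ => edgeInd_nonneg _ _ _)
        (by simp [hr, hj])
  · rw [edgeInd, if_neg h]
    exact sum_nonneg fun _ _ => edgeInd_nonneg _ _ _

lemma potential_collapse_ge (G : SimpleGraph α) {R U : Finset α} (φ : α → Fin 3)
    (hU : Disjoint U R) (J : Finset (Fin 3)) :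
    potential G (U ∪ R) + (10 * #J - 3 * ∑ i ∈ J, ∑ j ∈ J, if i = j then 0 else 1)
        + 6 * ∑ a ∈ U, ∑ r ∈ R with φ r ∉ J, edgeInd G a r ≤
      potential (collapse G R φ) (U.disjSum J) + potential G R := by
  have h1 : cut G U R = ∑ a ∈ U, ∑ r ∈ R with φ r ∈ J, edgeInd G a r +
      ∑ a ∈ U, ∑ r ∈ R with φ r ∉ J, edgeInd G a r := by
    rw [← sum_add_distrib]
    exact sum_congr rfl fun a _ => (sum_filter_add_sum_filter_not _ _ _).symm
  have h2 : ∑ a ∈ U, ∑ j ∈ J, edgeInd (collapse G R φ) (.inl a) (.inr j) ≤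
      ∑ a ∈ U, ∑ r ∈ R with φ r ∈ J, edgeInd G a r :=
    sum_le_sum fun a _ => cut_collapse_le G R φ a J
  have h3 : cut (collapse G R φ) (U.disjSum J) (U.disjSum J) = cut G U U +
      2 * ∑ a ∈ U, ∑ j ∈ J, edgeInd (collapse G R φ) (.inl a) (.inr j) +
      ∑ i ∈ J, ∑ j ∈ J, (if i = j then 0 else 1) := by
    unfold cut
    simp only [sum_disjSum, sum_add_distrib]
    rw [sum_comm (s := J) (t := U)]
    have e1 : ∀ a b, edgeInd (collapse G R φ) (.inl a) (.inl b) = edgeInd G a b := fun a b => rfl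
    have e2 : ∀ i j, edgeInd (collapse G R φ) (.inr i) (.inr j) = if i = j then 0 else 1 := by
      intro i j
      by_cases h : i = j <;> simp [edgeInd, collapse, h]
    simp only [e1, e2, edgeInd_comm _ (Sum.inr _) (Sum.inl _)]
    ring
  rw [potential_union G hU]
  unfold potential
  rw [h3, card_disjSum]
  push_cast
  linarith

end collapse

section critical

variable {α : Type u}

/-- A minimal counterexample to the Kostochka–Yancey bound for `4`-critical graphs. -/
structure IsMinCounterexample (G : SimpleGraph α) (A : Finset α) : Prop where
  not_colorableOn : ¬ ColorableOn G A
  lt_potential : 4 < potential G A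
  colorableOn_of_ssubset : ∀ W, W ⊂ A → ColorableOn G W
  exists_of_card_lt : ∀ {β : Type u} (H : SimpleGraph β) (B : Finset β), #B < #A →
    ¬ ColorableOn H B → ∃ W ⊆ B, ¬ ColorableOn H W ∧ potential H W ≤ 4

namespace IsMinCounterexample

variable {G : SimpleGraph α} {A : Finset α} (hG : IsMinCounterexample G A)
include hG

lemma exists_extension {R : Finset α} (hRA : R ⊂ A) (hR : 4 ≤ #R) {φ : α → Fin 3}
    (hφ : ∀ a ∈ R, ∀ b ∈ R, G.Adj a b → φ a ≠ φ b) :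
    ∃ U ⊆ A \ R, ∃ J : Finset (Fin 3), J.Nonempty ∧
      potential G (U ∪ R) + (10 * #J - 3 * ∑ i ∈ J, ∑ j ∈ J, if i = j then 0 else 1)
        + 6 * ∑ a ∈ U, ∑ r ∈ R with φ r ∉ J, edgeInd G a r ≤ 4 + potential G R := by
  have hcard : #((A \ R).disjSum (univ : Finset (Fin 3))) < #A := by
    have := card_sdiff_add_card_eq_card hRA.1
    simp only [card_disjSum, card_univ, Fintype.card_fin]
    omega
  obtain ⟨W, hWA, hW, hpot⟩ := hG.exists_of_card_lt (collapse G R φ) _ hcard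
    (not_colorableOn_collapse hφ hG.not_colorableOn)
  have hWeq : W.toLeft.disjSum W.toRight = W := W.toLeft_disjSum_toRight
  have hU : W.toLeft ⊆ A \ R := by
    intro a ha
    have := hWA (mem_toLeft.1 ha)
    simpa using this
  refine ⟨W.toLeft, hU, W.toRight, ?_, ?_⟩
  · rw [nonempty_iff_ne_empty]
    intro hJ
    apply hW
    obtain ⟨ψ, hψ⟩ := hG.colorableOn_of_ssubset W.toLeft (by
      refine ⟨hU.trans sdiff_subset, fun h => ?_⟩
      obtain ⟨r, hr⟩ : R.Nonempty := card_pos.1 (by omega)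
      have := hU (h (hRA.1 hr))
      simp [hr] at this)
    refine ⟨Sum.elim ψ fun _ => 0, ?_⟩
    rw [← hWeq, hJ]
    rintro (a | i) ha (b | j) hb hab <;> simp at ha hb
    exact hψ a (by simpa using ha) b (by simpa using hb) hab
  · have := potential_collapse_ge G (R := R) φ
      (disjoint_of_subset_left hU sdiff_disjoint) W.toRight
    rw [hWeq] at this
    linarith

omit hG in
lemma ten_le_trianglePotential {J : Finset (Fin 3)} (hJ : J.Nonempty) :
    10 ≤ (10 * #J - 3 * ∑ i ∈ J, ∑ j ∈ J, if i = j then 0 else 1 : ℤ) := by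
  revert J; decide

omit hG in
lemma twelve_le_trianglePotential {J : Finset (Fin 3)} (hJ : 2 ≤ #J) :
    12 ≤ (10 * #J - 3 * ∑ i ∈ J, ∑ j ∈ J, if i = j then 0 else 1 : ℤ) := by
  revert J; decide

lemma ten_lt_potential {R : Finset α} (hRA : R ⊂ A) (hR : 4 ≤ #R) : 10 < potential G R := by
  by_contra! hlow
  obtain ⟨R, hRmem, hmin⟩ := exists_min_image
    (A.powerset.filter fun R => R ≠ A ∧ 4 ≤ #R ∧ potential G R ≤ 10) (potential G)
    ⟨R, by simp [hRA.1, hRA.ne, hR, hlow]⟩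
  simp only [mem_filter, mem_powerset] at hRmem hmin
  obtain ⟨hRA, hne, hR, hlow⟩ := hRmem
  have hss := hRA.ssubset_of_ne hne
  obtain ⟨φ, hφ⟩ := hG.colorableOn_of_ssubset R hss
  obtain ⟨U, hU, J, hJ, h⟩ := hG.exists_extension hss hR hφ
  have h1 := ten_le_trianglePotential hJ
  have h2 : 0 ≤ ∑ a ∈ U, ∑ r ∈ R with φ r ∉ J, edgeInd G a r :=
    sum_nonneg fun _ _ => sum_nonneg fun _ _ => edgeInd_nonneg G _ _
  have hsub : U ∪ R ⊆ A := union_subset (hU.trans sdiff_subset) hRA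
  by_cases hA : U ∪ R = A
  · have := hG.lt_potential
    rw [hA] at h
    linarith
  · have := hmin (U ∪ R) ⟨hsub, hA, hR.trans (card_le_card subset_union_right), by linarith⟩
    linarith

lemma exists_two_boundary {R : Finset α} (hRA : R ⊂ A) (hR : 4 ≤ #R) :
    ∃ u ∈ R, ∃ v ∈ R, u ≠ v ∧ (∃ a ∈ A \ R, G.Adj a u) ∧ ∃ a ∈ A \ R, G.Adj a v := by
  by_contra! hcon
  obtain ⟨φ, hφ⟩ := hG.colorableOn_of_ssubset R hRA
  have key : ∃ x, ∀ r ∈ R, ∀ a ∈ A \ R, G.Adj a r → r = x := by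
    by_cases h : ∃ u ∈ R, ∃ a ∈ A \ R, G.Adj a u
    · obtain ⟨u, hu, hau⟩ := h
      refine ⟨u, fun r hr a ha har => ?_⟩
      by_contra hne
      exact hcon u hu r hr (Ne.symm hne) hau a ha har
    · push Not at h
      obtain ⟨x, -⟩ := exists_of_ssubset hRA
      exact ⟨x, fun r hr a ha har => absurd har (h r hr a ha)⟩
  obtain ⟨x, hx⟩ := key
  obtain ⟨ψ, hψ⟩ := hG.colorableOn_of_ssubset ((A \ R) ∪ R.filter (· = x)) (by
    refine ⟨union_subset sdiff_subset ((filter_subset _ _).trans hRA.1), fun hsub => ?_⟩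
    obtain ⟨r, hr, hrx⟩ := exists_mem_ne (s := R) (by omega) x
    have := hsub (hRA.1 hr)
    simp [hrx, hr] at this)
  apply hG.not_colorableOn
  have cross : ∀ r ∈ R, ∀ a ∈ A \ R, G.Adj a r → φ r ≠ Equiv.swap (ψ x) (φ x) (ψ a) := by
    intro r hr a ha har h
    obtain rfl := hx r hr a ha har
    refine hψ a (mem_union_left _ ha) r (by simp [hr]) har ?_
    apply (Equiv.swap (ψ r) (φ r)).injective
    rw [← h, Equiv.swap_apply_left]
  refine ⟨fun a => if a ∈ R then φ a else Equiv.swap (ψ x) (φ x) (ψ a), fun a ha b hb hab => ?_⟩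
  by_cases haR : a ∈ R <;> by_cases hbR : b ∈ R <;> simp only [haR, hbR, if_true, if_false]
  · exact hφ a haR b hbR hab
  · exact cross a haR b (by simp [hb, hbR]) hab.symm
  · exact (cross b hbR a (by simp [ha, haR]) hab).symm
  · exact fun h => hψ a (by simp [ha, haR]) b (by simp [hb, hbR]) hab
      ((Equiv.swap (ψ x) (φ x)).injective h)

lemma exists_coloring_ne {R : Finset α} (hRA : R ⊂ A) {u v : α} (hu : u ∈ R) (hv : v ∈ R)
    (huv : u ≠ v) :
    ∃ φ : α → Fin 3, (∀ a ∈ R, ∀ b ∈ R, G.Adj a b → φ a ≠ φ b) ∧ φ u ≠ φ v := by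
  let H := G ⊔ SimpleGraph.edge u v
  have hle : ∀ a b, edgeInd H a b ≤ edgeInd G a b +
      ((if a = u ∧ b = v then 1 else 0) + if a = v ∧ b = u then 1 else 0) := by
    intro a b
    have := edgeInd_nonneg G a b
    by_cases h : G.Adj a b
    · have h1 := edgeInd_le_one H a b
      rw [edgeInd_of_adj h]
      split_ifs <;> linarith
    · by_cases h' : H.Adj a b
      · have : (u = a ∧ v = b ∨ u = b ∧ v = a) := by
          simp [H, h, SimpleGraph.edge_adj] at h'; tauto
        rw [edgeInd_of_adj h']
        rcases this with ⟨rfl, rfl⟩ | ⟨rfl, rfl⟩ <;> simp <;> split_ifs <;> linarith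
      · rw [edgeInd, if_neg h']
        split_ifs <;> linarith
  by_cases hH : ColorableOn H R
  · obtain ⟨φ, hφ⟩ := hH
    exact ⟨φ, fun a ha b hb hab => hφ a ha b hb (Or.inl hab),
      hφ u hu v hv (Or.inr (by simp [SimpleGraph.edge_adj, huv]))⟩
  · exfalso
    obtain ⟨W, hWR, hW, hpot⟩ := hG.exists_of_card_lt H R (card_lt_card hRA) hH
    have h10 := hG.ten_lt_potential (R := W) (hWR.trans_ssubset hRA)
      (four_le_card_of_not_colorableOn hW)
    have : cut H W W ≤ cut G W W + 2 := by
      have h1 : ∀ x y : α, ∑ a ∈ W, ∑ b ∈ W, (if a = x ∧ b = y then (1 : ℤ) else 0) ≤ 1 := by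
        intro x y
        simp only [ite_and, sum_ite_eq', sum_ite_irrel, sum_const_zero]
        split_ifs <;> simp
      calc cut H W W ≤ ∑ a ∈ W, ∑ b ∈ W, (edgeInd G a b +
          ((if a = u ∧ b = v then 1 else 0) + if a = v ∧ b = u then 1 else 0)) :=
            sum_le_sum fun a _ => sum_le_sum fun b _ => hle a b
        _ ≤ _ := by
            simp only [sum_add_distrib]
            have := h1 u v
            have := h1 v u
            unfold cut
            linarith
    unfold potential at *
    linarith

lemma twelve_lt_potential {R : Finset α} (hRA : R ⊂ A) (hR : 4 ≤ #R) : 12 < potential G R := by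
  by_contra! hlow
  obtain ⟨u, hu, v, hv, huv, ⟨a, ha, hau⟩, b, hb, hbv⟩ := hG.exists_two_boundary hRA hR
  obtain ⟨φ, hφ, hne⟩ := hG.exists_coloring_ne hRA hu hv huv
  obtain ⟨U, hU, J, hJ, h⟩ := hG.exists_extension hRA hR hφ
  have h2 : 0 ≤ ∑ a ∈ U, ∑ r ∈ R with φ r ∉ J, edgeInd G a r :=
    sum_nonneg fun _ _ => sum_nonneg fun _ _ => edgeInd_nonneg G _ _
  have h1 := ten_le_trianglePotential hJ
  have hsub : U ∪ R ⊆ A := union_subset (hU.trans sdiff_subset) hRA.1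
  by_cases hA : U ∪ R = A
  · have hlt := hG.lt_potential
    rw [hA] at h
    by_cases hJ2 : 2 ≤ #J
    · have := twelve_le_trianglePotential hJ2
      linarith
    · have hUeq : ∀ c ∈ A \ R, c ∈ U := by
        intro c hc
        rw [mem_sdiff, ← hA, mem_union] at hc
        tauto
      obtain ⟨j, rfl⟩ := card_eq_one.1 (by have := hJ.card_pos; omega : #J = 1)
      have key : ∀ r ∈ R, ∀ c ∈ A \ R, G.Adj c r → φ r ≠ j →
          1 ≤ ∑ a ∈ U, ∑ r ∈ R with φ r ∉ ({j} : Finset (Fin 3)), edgeInd G a r := by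
        intro r hr c hc hcr hj
        calc 1 = edgeInd G c r := (edgeInd_of_adj hcr).symm
          _ ≤ ∑ r ∈ R with φ r ∉ ({j} : Finset (Fin 3)), edgeInd G c r :=
            single_le_sum (f := fun r => edgeInd G c r) (fun _ _ => edgeInd_nonneg _ _ _)
              (by simp [hr, hj])
          _ ≤ _ := single_le_sum
              (f := fun a => ∑ r ∈ R with φ r ∉ ({j} : Finset (Fin 3)), edgeInd G a r)
              (fun _ _ => sum_nonneg fun _ _ => edgeInd_nonneg _ _ _) (hUeq c hc)
      have : 1 ≤ ∑ a ∈ U, ∑ r ∈ R with φ r ∉ ({j} : Finset (Fin 3)), edgeInd G a r := by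
        by_cases huj : φ u = j
        · exact key v hv b hb hbv (huj ▸ hne.symm)
        · exact key u hu a ha hau huj
      linarith
  · have := hG.ten_lt_potential (hsub.ssubset_of_ne hA)
      (hR.trans (card_le_card subset_union_right))
    linarith

omit hG in
lemma exists_color_notMem {s : Finset (Fin 3)} (hs : #s ≤ 2) : ∃ c, c ∉ s := by
  revert s; decide

lemma three_le_degree {x : α} (hx : x ∈ A) : 3 ≤ #(A.filter (G.Adj x)) := by
  by_contra! hlt
  obtain ⟨φ, hφ⟩ := hG.colorableOn_of_ssubset _ (erase_ssubset hx)
  obtain ⟨c, hc⟩ := exists_color_notMem (s := (A.filter (G.Adj x)).image φ)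
    (card_image_le.trans (by omega))
  have hc : ∀ y ∈ A, G.Adj x y → φ y ≠ c := fun y hy hxy h =>
    hc (mem_image.2 ⟨y, by simp [hy, hxy], h⟩)
  refine hG.not_colorableOn ⟨Function.update φ x c, fun a ha b hb hab => ?_⟩
  by_cases hax : a = x <;> by_cases hbx : b = x
  · subst hax; subst hbx; exact absurd hab (G.irrefl)
  · subst hax; simpa [hbx] using (hc b hb hab).symm
  · subst hbx; simpa [hax] using hc a ha hab.symm
  · simpa [hax, hbx] using hφ a (by simp [hax, ha]) b (by simp [hbx, hb]) hab

/-- The graph in which the neighbours of `b` are also made adjacent to `a`. -/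
def absorb (G : SimpleGraph α) {a b : α} (hab : ¬ G.Adj a b) : SimpleGraph α where
  Adj u v := G.Adj u v ∨ (u = a ∧ G.Adj b v) ∨ (v = a ∧ G.Adj b u)
  symm := by
    constructor
    rintro u v (h | h | h)
    · exact Or.inl h.symm
    · exact Or.inr (Or.inr h)
    · exact Or.inr (Or.inl h)
  loopless := by
    constructor
    rintro u (h | ⟨rfl, h⟩ | ⟨rfl, h⟩)
    · exact G.irrefl h
    · exact hab h.symm
    · exact hab h.symm

omit hG in
lemma colorableOn_of_absorb {x y a b : α} (hx : x ∈ A) (hxy : G.Adj x y)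
    (hdy : #(A.filter (G.Adj y)) = 3) (ha : a ∈ A) (hay : a ≠ y)
    (hax : a ≠ x) (hNx : ∀ c ∈ A, G.Adj x c → c = y ∨ c = a ∨ c = b) (hab : ¬ G.Adj a b)
    (h : ColorableOn (absorb G hab) (A \ {x, y, b})) (hne : a ≠ b) : ColorableOn G A := by
  obtain ⟨ψ, hψ⟩ := h
  have haB : a ∈ A \ {x, y, b} := by simp [*]
  let φ := Function.update ψ b (ψ a)
  have hφa : φ a = ψ a := by simp [φ, hne]
  have hφb : φ b = ψ a := by simp [φ]
  have hφ : ∀ u ∈ A, ∀ v ∈ A, u ≠ x → u ≠ y → v ≠ x → v ≠ y → G.Adj u v → φ u ≠ φ v := by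
    intro u hu v hv hux huy hvx hvy huv
    by_cases hub : u = b <;> by_cases hvb : v = b
    · subst hub; subst hvb; exact absurd huv G.irrefl
    · subst hub
      have hva : v ≠ a := fun h => hab (h ▸ huv.symm)
      rw [hφb]
      simp only [φ, Function.update_of_ne hvb]
      exact hψ a haB v (by simp [*]) (Or.inr (Or.inl ⟨rfl, huv⟩))
    · subst hvb
      have hva : u ≠ a := fun h => hab (h ▸ huv)
      rw [hφb]
      simp only [φ, Function.update_of_ne hub]
      exact hψ u (by simp [*]) a haB (Or.inr (Or.inr ⟨rfl, huv.symm⟩))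
    · simp only [φ, Function.update_of_ne hub, Function.update_of_ne hvb]
      exact hψ u (by simp [*]) v (by simp [*]) (Or.inl huv)
  obtain ⟨cy, hcy⟩ := exists_color_notMem (s := ((A.filter (G.Adj y)).erase x).image φ)
    (card_image_le.trans (by rw [card_erase_of_mem (by simp [hx, hxy.symm]), hdy]))
  have hcy : ∀ v ∈ A, v ≠ x → G.Adj y v → φ v ≠ cy := fun v hv hvx hyv h =>
    hcy (mem_image.2 ⟨v, by simp [hv, hyv, hvx], h⟩)
  obtain ⟨cx, hcx⟩ := exists_color_notMem (s := {cy, ψ a}) card_le_two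
  simp only [mem_insert, mem_singleton, not_or] at hcx
  have hxc : ∀ v ∈ A, v ≠ y → G.Adj x v → φ v ≠ cx := by
    intro v hv hvy hxv
    rcases hNx v hv hxv with rfl | rfl | rfl
    · exact absurd rfl hvy
    · rw [hφa]; exact Ne.symm hcx.2
    · rw [hφb]; exact Ne.symm hcx.2
  have hxy' := hxy.ne
  refine ⟨fun u => if u = x then cx else if u = y then cy else φ u, fun u hu v hv huv => ?_⟩
  by_cases hux : u = x <;> by_cases hvx : v = x <;> by_cases huy : u = y <;>
    by_cases hvy : v = y <;> simp only [hux, hvx, huy, hvy, if_true, if_false]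
  all_goals first
    | (subst_vars; first | exact absurd huv G.irrefl | exact absurd rfl hxy')
    | skip
  · rw [if_neg hxy'.symm]; exact hcx.1
  · rw [← hux] at hxc
    exact (hxc v hv hvy huv).symm
  · rw [if_neg hxy'.symm]; exact Ne.symm hcx.1
  · rw [← hvx] at hxc
    exact hxc u hu huy huv.symm
  · rw [if_neg hxy'.symm]
    rw [← huy] at hcy
    exact (hcy v hv hvx huv).symm
  · rw [if_neg hxy'.symm]
    rw [← hvy] at hcy
    exact hcy u hu hux huv.symm
  · exact hφ u hu v hv hux huy hvx hvy huv

omit hG in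
lemma potential_absorb {a b : α} {W : Finset α} (ha : a ∈ W) (hb : b ∉ W) (hab : ¬ G.Adj a b) :
    potential G (insert b W) ≤ potential (absorb G hab) W + 10 := by
  rw [← insert_erase ha, potential_insert G (by rw [insert_erase ha]; exact hb),
    potential_insert G (by simp), potential_insert _ (by simp)]
  have h1 : potential (absorb G hab) (W.erase a) = potential G (W.erase a) := by
    unfold potential cut
    congr 2
    refine sum_congr rfl fun u hu => sum_congr rfl fun v hv => ?_
    have hu' := ne_of_mem_erase hu
    have hv' := ne_of_mem_erase hv
    simp [edgeInd, absorb, hu', hv']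
  have h2 : ∑ v ∈ W.erase a, edgeInd (absorb G hab) a v ≤
      ∑ v ∈ W.erase a, (edgeInd G a v + edgeInd G b v) := by
    refine sum_le_sum fun v hv => ?_
    have h1 := edgeInd_nonneg G a v
    have h2 := edgeInd_nonneg G b v
    by_cases h : (absorb G hab).Adj a v
    · rw [edgeInd_of_adj h]
      rcases h with h | ⟨-, h⟩ | ⟨h, -⟩
      · rw [edgeInd_of_adj h]; linarith
      · rw [edgeInd_of_adj h]; linarith
      · exact absurd h (ne_of_mem_erase hv)
    · rw [edgeInd, if_neg h]; linarith
  rw [sum_add_distrib] at h2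
  have h3 : ∑ v ∈ W.erase a, edgeInd G b v ≤ ∑ v ∈ insert a (W.erase a), edgeInd G b v :=
    sum_le_sum_of_subset_of_nonneg (subset_insert _ _) fun _ _ _ => edgeInd_nonneg _ _ _
  linarith

lemma adj_of_degree_eq_three {x y a b : α} (hx : x ∈ A) (hy : y ∈ A) (hxy : G.Adj x y)
    (hdx : #(A.filter (G.Adj x)) = 3) (hdy : #(A.filter (G.Adj y)) = 3) (ha : a ∈ A) (hb : b ∈ A)
    (hxa : G.Adj x a) (hxb : G.Adj x b) (hay : a ≠ y) (hby : b ≠ y) (hne : a ≠ b) :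
    G.Adj a b := by
  by_contra hab
  have hN : {y, a, b} = A.filter (G.Adj x) := by
    refine eq_of_subset_of_card_le ?_ ?_
    · intro c hc
      simp only [mem_insert, mem_singleton] at hc
      rcases hc with rfl | rfl | rfl <;> simp [*]
    · rw [hdx, card_eq_three.2 ⟨y, a, b, hay.symm, hby.symm, hne, rfl⟩]
  have hNx : ∀ c ∈ A, G.Adj x c → c = y ∨ c = a ∨ c = b := by
    intro c hc hxc
    have : c ∈ A.filter (G.Adj x) := by simp [hc, hxc]
    rw [← hN] at this
    simpa using this
  have hcard : #(A \ {x, y, b}) < #A := by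
    refine card_lt_card (sdiff_ssubset ?_ (by simp))
    intro c hc
    simp only [mem_insert, mem_singleton] at hc
    rcases hc with rfl | rfl | rfl <;> assumption
  obtain ⟨W, hWB, hW, hpot⟩ := hG.exists_of_card_lt (absorb G hab) _ hcard fun h =>
    hG.not_colorableOn (colorableOn_of_absorb hx hxy hdy ha hay hxa.ne' hNx hab h hne)
  have hW' : ∀ w ∈ W, w ∈ A ∧ w ≠ x ∧ w ≠ y ∧ w ≠ b := by
    intro w hw
    simpa using hWB hw
  have haW : a ∈ W := by
    by_contra haW
    apply hW
    obtain ⟨φ, hφ⟩ := hG.colorableOn_of_ssubset W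
      ⟨fun w hw => (hW' w hw).1, fun h => (hW' x (h hx)).2.1 rfl⟩
    refine ⟨φ, fun u hu v hv huv => hφ u hu v hv ?_⟩
    rcases huv with h | ⟨rfl, -⟩ | ⟨rfl, -⟩
    · exact h
    · exact absurd hu haW
    · exact absurd hv haW
  have hbW : b ∉ W := fun h => (hW' b h).2.2.2 rfl
  have hxW : x ∉ insert b W := by
    rw [mem_insert, not_or]
    exact ⟨hxb.ne, fun h => (hW' x h).2.1 rfl⟩
  have h1 := potential_absorb haW hbW hab
  have h2 := potential_insert G hxW
  have h3 : 2 ≤ ∑ c ∈ insert b W, edgeInd G x c := by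
    rw [sum_insert hbW, edgeInd_of_adj hxb]
    have := single_le_sum (f := fun c => edgeInd G x c) (fun _ _ => edgeInd_nonneg _ _ _) haW
    simp only [edgeInd_of_adj hxa] at this
    linarith
  have h4 : insert x (insert b W) ⊂ A := by
    refine ⟨insert_subset hx (insert_subset hb fun w hw => (hW' w hw).1), fun h => ?_⟩
    have := h hy
    simp only [mem_insert] at this
    rcases this with h | h | h
    · exact hxy.ne' h
    · exact hby h.symm
    · exact (hW' y h).2.2.1 rfl
  have h5 := hG.twelve_lt_potential h4 ((four_le_card_of_not_colorableOn hW).trans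
    (card_le_card ((subset_insert _ _).trans (subset_insert _ _))))
  linarith

lemma card_degree_three_neighbors_le {x : α} (hx : x ∈ A) (hdx : #(A.filter (G.Adj x)) = 3) :
    #(A.filter fun y => G.Adj x y ∧ #(A.filter (G.Adj y)) = 3) ≤ 1 := by
  rw [card_le_one]
  simp only [mem_filter]
  rintro y ⟨hy, hxy, hdy⟩ a ⟨ha, hxa, hda⟩
  by_contra hne
  obtain ⟨b, hb, hby, hba⟩ : ∃ b ∈ A.filter (G.Adj x), b ≠ y ∧ b ≠ a := by
    by_contra! hcon
    have : A.filter (G.Adj x) ⊆ {y, a} := fun b hb => by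
      by_cases hby : b = y
      · simp [hby]
      · simp [hcon b hb hby]
    have := (card_le_card this).trans card_le_two
    omega
  rw [mem_filter] at hb
  have hab := hG.adj_of_degree_eq_three hx hy hxy hdx hdy ha hb.1 hxa hb.2 (Ne.symm hne) hby hba.symm
  have hyb := hG.adj_of_degree_eq_three hx ha hxa hdx hda hy hb.1 hxy hb.2 hne hba hby.symm
  have hsub : {x, b, y, a} ⊆ A := by
    intro c hc
    simp only [mem_insert, mem_singleton] at hc
    rcases hc with rfl | rfl | rfl | rfl
    exacts [hx, hb.1, hy, ha]
  have hcard : #({x, b, y, a} : Finset α) = 4 := by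
    rw [card_insert_of_notMem, card_eq_three.2 ⟨b, y, a, hby, hba, hne, rfl⟩]
    simp [hb.2.ne, hxy.ne, hxa.ne]
  have hpot : potential G {x, b, y, a} ≤ 10 := by
    rw [potential_insert G (by simp [hb.2.ne, hxy.ne, hxa.ne]),
      potential_insert G (by simp [hby, hba]), potential_insert G (by simp [hne])]
    have h0 := edgeInd_nonneg G y a
    rw [sum_insert (by simp [hne]), sum_insert (by simp [hby, hba]), sum_insert (by simp [hne])]
    simp only [sum_singleton, edgeInd_of_adj hxy, edgeInd_of_adj hb.2, edgeInd_of_adj hxa,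
      edgeInd_of_adj hab.symm, edgeInd_of_adj hyb.symm]
    simp only [potential, cut, card_singleton, sum_singleton, edgeInd_self]
    push_cast
    linarith
  by_cases hA : {x, b, y, a} = A
  · have h1 := three_le_degree hG hy
    have hya : G.Adj y a := by
      by_contra hya
      have : A.filter (G.Adj y) ⊆ {x, b} := by
        intro c hc
        rw [mem_filter, ← hA] at hc
        simp only [mem_insert, mem_singleton] at hc ⊢
        rcases hc with ⟨rfl | rfl | rfl | rfl, h⟩
        · exact Or.inl rfl
        · exact Or.inr rfl
        · exact absurd h G.irrefl
        · exact absurd h hya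
      have := (card_le_card this).trans card_le_two
      omega
    have h2 := hG.lt_potential
    rw [← hA] at h2
    rw [potential_insert G (by simp [hb.2.ne, hxy.ne, hxa.ne]),
      potential_insert G (by simp [hby, hba]), potential_insert G (by simp [hne])] at h2
    rw [sum_insert (by simp [hne]), sum_insert (by simp [hby, hba]),
      sum_insert (by simp [hne])] at h2
    simp only [sum_singleton, edgeInd_of_adj hxy, edgeInd_of_adj hb.2, edgeInd_of_adj hxa,
      edgeInd_of_adj hab.symm, edgeInd_of_adj hyb.symm, edgeInd_of_adj hya] at h2
    simp only [potential, cut, card_singleton, sum_singleton, edgeInd_self] at h2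
    norm_num at h2
  · have := hG.ten_lt_potential (hsub.ssubset_of_ne hA) hcard.ge
    linarith

lemma false : False := by
  let d : α → ℕ := fun a => #(A.filter (G.Adj a))
  have hd : ∀ a, ∑ b ∈ A, edgeInd G a b = d a := by
    intro a
    simp [edgeInd, d]
  let T := A.filter (d · = 3)
  let B := A.filter (d · ≠ 3)
  have hpot := hG.lt_potential
  have hsum : cut G A A = ∑ a ∈ T, (d a : ℤ) + ∑ a ∈ B, (d a : ℤ) := by
    rw [sum_filter_add_sum_filter_not]
    exact sum_congr rfl fun a _ => hd a
  have hT : ∑ a ∈ T, (d a : ℤ) = 3 * #T := by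
    rw [sum_congr rfl (g := fun _ => (3 : ℤ)) fun a ha => by
      have := (mem_filter.1 ha).2; exact_mod_cast this]
    simp [mul_comm]
  have hB : 4 * (#B : ℤ) ≤ ∑ a ∈ B, (d a : ℤ) := by
    rw [mul_comm, ← nsmul_eq_mul, ← sum_const]
    refine sum_le_sum fun a ha => ?_
    have h1 := (mem_filter.1 ha).2
    have h2 := hG.three_le_degree (mem_filter.1 ha).1
    have : 4 ≤ d a := by simp only [d] at h1 ⊢; omega
    exact_mod_cast this
  have hTB : 2 * (#T : ℤ) ≤ cut G T B := by
    rw [mul_comm, ← nsmul_eq_mul, ← sum_const]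
    refine sum_le_sum fun a ha => ?_
    have h1 : d a = 3 := (mem_filter.1 ha).2
    have h2 := hG.card_degree_three_neighbors_le (mem_filter.1 ha).1 h1
    have h3 : ∑ b ∈ T, edgeInd G a b + ∑ b ∈ B, edgeInd G a b = d a := by
      rw [← hd a]
      exact sum_filter_add_sum_filter_not _ _ _
    have h4 : ∑ b ∈ T, edgeInd G a b ≤ 1 := by
      have : ∑ b ∈ T, edgeInd G a b = #(A.filter fun y => G.Adj a y ∧ #(A.filter (G.Adj y)) = 3) := by
        simp only [edgeInd, sum_boole, T, filter_filter, d]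
        simp only [and_comm]
      rw [this]
      exact_mod_cast h2
    rw [h1] at h3
    push_cast at h3
    linarith
  have hBT : cut G T B ≤ ∑ a ∈ B, (d a : ℤ) := by
    rw [cut_comm]
    refine sum_le_sum fun a _ => ?_
    rw [← hd a]
    exact sum_le_sum_of_subset_of_nonneg (filter_subset _ _) fun _ _ _ => edgeInd_nonneg _ _ _
  have hcard : (#A : ℤ) = #T + #B := by
    exact_mod_cast (card_filter_add_card_filter_not (s := A) (d · = 3)).symm
  unfold potential at hpot
  rw [hsum, hT, hcard] at hpot
  linarith

end IsMinCounterexample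

/-- The Kostochka–Yancey bound for `4`-critical graphs. -/
theorem exists_potential_le_four {α : Type u} (G : SimpleGraph α) (A : Finset α)
    (h : ¬ ColorableOn G A) : ∃ W ⊆ A, ¬ ColorableOn G W ∧ potential G W ≤ 4 := by
  induction hn : #A using Nat.strong_induction_on generalizing α with
  | _ n ih =>
    subst hn
    by_contra! hcon
    refine IsMinCounterexample.false (G := G) (A := A) ⟨h, hcon A subset_rfl h, ?_, ?_⟩
    · intro W hW
      by_contra hWc
      obtain ⟨W', hW', hc, hp⟩ := ih _ (card_lt_card hW) G W hWc rfl
      exact absurd hp (not_le.2 (hcon W' (hW'.trans hW.1) hc))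
    · intro β H B hB hH
      exact ih _ hB H B hH rfl

end critical

section facial

variable {V : Type u} [Fintype V]

/-- A mod `2` one-cycle of a graph, as a symmetric matrix supported on the edges. -/
structure IsEvenChain (G : SimpleGraph V) (z : V → V → ZMod 2) : Prop where
  symm : ∀ u v, z u v = z v u
  eq_zero : ∀ u v, ¬ G.Adj u v → z u v = 0
  sum_eq_zero : ∀ u, ∑ v, z u v = 0

/-- The boundary of a mod `2` combination `w` of faces, where `l u v` is the face on the left of
the dart `(u, v)`. -/
noncomputable def faceBoundary {Φ : Type} (G : SimpleGraph V) (l : V → V → Φ) (w : Φ → ZMod 2)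
    (u v : V) : ZMod 2 :=
  if G.Adj u v then w (l u v) + w (l v u) else 0

/-- The face boundaries of `l` span exactly the mod `2` cycle space of `G`. -/
structure IsFacial {Φ : Type} (G : SimpleGraph V) (l : V → V → Φ) : Prop where
  sum_faceBoundary : ∀ w u, ∑ v, faceBoundary G l w u v = 0
  exists_eq : ∀ z, IsEvenChain G z → ∃ w, z = faceBoundary G l w

/-- Planarity in the sense of Mac Lane. -/
def MacLanePlanar (G : SimpleGraph V) : Prop :=
  ∃ (Φ : Type) (l : V → V → Φ), IsFacial G l

omit [Fintype V] in
lemma faceBoundary_symm {Φ : Type} (G : SimpleGraph V) (l : V → V → Φ) (w : Φ → ZMod 2)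
    (u v : V) : faceBoundary G l w u v = faceBoundary G l w v u := by
  simp only [faceBoundary, G.adj_comm u v, add_comm]

omit [Fintype V] in
lemma faceBoundary_of_adj {Φ : Type} {G : SimpleGraph V} (l : V → V → Φ) (w : Φ → ZMod 2)
    {u v : V} (h : G.Adj u v) : faceBoundary G l w u v = w (l u v) + w (l v u) :=
  if_pos h

omit [Fintype V] in
lemma faceBoundary_of_not_adj {Φ : Type} {G : SimpleGraph V} (l : V → V → Φ) (w : Φ → ZMod 2)
    {u v : V} (h : ¬ G.Adj u v) : faceBoundary G l w u v = 0 :=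
  if_neg h

lemma IsFacial.isEvenChain {Φ : Type} {G : SimpleGraph V} {l : V → V → Φ} (hl : IsFacial G l)
    (w : Φ → ZMod 2) : IsEvenChain G (faceBoundary G l w) where
  symm := faceBoundary_symm G l w
  eq_zero _ _ h := faceBoundary_of_not_adj l w h
  sum_eq_zero := hl.sum_faceBoundary w

/-- Merge the faces on both sides of the edges of `G` that are not in `H`. -/
def mergedFace {Φ : Type} (G H : SimpleGraph V) (l : V → V → Φ) (u v : V) :
    Quot fun x y => ∃ u v, G.Adj u v ∧ ¬ H.Adj u v ∧ x = l u v ∧ y = l v u :=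
  Quot.mk _ (l u v)

lemma IsFacial.restrict {Φ : Type} {G H : SimpleGraph V} {l : V → V → Φ} (hl : IsFacial G l)
    (hHG : H ≤ G) : IsFacial H (mergedFace G H l) where
  sum_faceBoundary w u := by
    rw [← hl.sum_faceBoundary (fun x => w (Quot.mk _ x)) u]
    refine sum_congr rfl fun v _ => ?_
    by_cases hH : H.Adj u v
    · rw [faceBoundary_of_adj _ _ hH, faceBoundary_of_adj _ _ (hHG hH)]
      rfl
    · rw [faceBoundary_of_not_adj _ _ hH]
      by_cases hG : G.Adj u v
      · rw [faceBoundary_of_adj _ _ hG, Quot.sound ⟨u, v, hG, hH, rfl, rfl⟩]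
        exact (CharTwo.add_self_eq_zero _).symm
      · rw [faceBoundary_of_not_adj _ _ hG]
  exists_eq z hz := by
    obtain ⟨w, hw⟩ := hl.exists_eq z
      ⟨hz.symm, fun u v h => hz.eq_zero u v fun h' => h (hHG h'), hz.sum_eq_zero⟩
    refine ⟨Quot.lift w ?_, ?_⟩
    · rintro _ _ ⟨u, v, hG, hH, rfl, rfl⟩
      have h0 := hz.eq_zero u v hH
      rw [hw, faceBoundary_of_adj _ _ hG] at h0
      exact CharTwo.add_eq_zero.1 h0
    · ext1 u; ext1 v
      by_cases hH : H.Adj u v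
      · rw [faceBoundary_of_adj _ _ hH]
        exact (congrFun (congrFun hw u) v).trans (faceBoundary_of_adj _ _ (hHG hH))
      · rw [faceBoundary_of_not_adj _ _ hH, hz.eq_zero u v hH]

lemma MacLanePlanar.mono {G H : SimpleGraph V} (hG : MacLanePlanar G) (h : H ≤ G) :
    MacLanePlanar H := by
  obtain ⟨Φ, l, hl⟩ := hG
  exact ⟨_, _, hl.restrict h⟩

/-- The face `f` is bounded by the `4`-cycle `a b c d`. -/
structure IsFourFace {Φ : Type} (G : SimpleGraph V) (l : V → V → Φ) (f : Φ) (a b c d : V) :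
    Prop where
  adj_ab : G.Adj a b
  adj_bc : G.Adj b c
  adj_cd : G.Adj c d
  adj_da : G.Adj d a
  ne_ac : a ≠ c
  ne_bd : b ≠ d
  iff_ne : ∀ u v, G.Adj u v → (s(u, v) = s(a, b) ∨ s(u, v) = s(b, c) ∨ s(u, v) = s(c, d) ∨
    s(u, v) = s(d, a) ↔ ¬ (l u v = f ↔ l v u = f))

namespace IsFourFace

variable {Φ : Type} {G : SimpleGraph V} {l : V → V → Φ} {f : Φ} {a b c d : V}

omit [Fintype V] in
lemma rotate (h : IsFourFace G l f a b c d) : IsFourFace G l f b c d a where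
  adj_ab := h.adj_bc
  adj_bc := h.adj_cd
  adj_cd := h.adj_da
  adj_da := h.adj_ab
  ne_ac := h.ne_bd
  ne_bd := h.ne_ac.symm
  iff_ne u v huv := by rw [← h.iff_ne u v huv]; tauto

omit [Fintype V] in
lemma restrict (h : IsFourFace G l f a b c d) {H : SimpleGraph V} (hHG : H ≤ G)
    (hab : H.Adj a b) (hbc : H.Adj b c) (hcd : H.Adj c d) (hda : H.Adj d a) :
    IsFourFace H (mergedFace G H l) (Quot.mk _ f) a b c d where
  adj_ab := hab
  adj_bc := hbc
  adj_cd := hcd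
  adj_da := hda
  ne_ac := h.ne_ac
  ne_bd := h.ne_bd
  iff_ne u v huv := by
    have key : ∀ u v, mergedFace G H l u v = Quot.mk _ f ↔ l u v = f := by
      intro u v
      refine ⟨fun he => ?_, fun he => congrArg _ he⟩
      let p : (Quot fun x y => ∃ u v, G.Adj u v ∧ ¬ H.Adj u v ∧ x = l u v ∧ y = l v u) → Prop :=
        Quot.lift (· = f) (by
          rintro _ _ ⟨u, v, hG, hH, rfl, rfl⟩
          have := h.iff_ne u v hG
          refine propext (not_not.1 fun hn => hH ?_)
          rcases this.2 hn with h | h | h | h <;>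
            rw [← SimpleGraph.mem_edgeSet, h, SimpleGraph.mem_edgeSet] <;> assumption)
      have : p (mergedFace G H l u v) := by
        rw [he]
      exact this
    rw [key, key]
    exact h.iff_ne u v (hHG huv)

end IsFourFace

noncomputable def edgeChain (a b u v : V) : ZMod 2 :=
  if s(u, v) = s(a, b) then 1 else 0

omit [Fintype V] in
lemma edgeChain_symm (a b u v : V) : edgeChain a b u v = edgeChain a b v u := by
  simp [edgeChain, Sym2.eq_swap]

omit [Fintype V] in
lemma sum_edgeChain_of_mem {a b : V} (h : a ≠ b) {s : Finset V} (ha : a ∈ s) (hb : b ∈ s) (u : V) :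
    ∑ v ∈ s, edgeChain a b u v = (if u = a then 1 else 0) + if u = b then 1 else 0 := by
  have : ∀ v, edgeChain a b u v = (if v = b then (if u = a then 1 else 0) else 0) +
      if v = a then (if u = b then 1 else 0) else 0 := by
    intro v
    simp only [edgeChain, Sym2.eq_iff]
    by_cases h1 : u = a <;> by_cases h2 : v = b <;> by_cases h3 : u = b <;>
      by_cases h4 : v = a <;> simp_all
  simp [this, sum_add_distrib, ha, hb]

lemma sum_edgeChain {a b : V} (h : a ≠ b) (u : V) :
    ∑ v, edgeChain a b u v = (if u = a then 1 else 0) + if u = b then 1 else 0 :=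
  sum_edgeChain_of_mem h (mem_univ a) (mem_univ b) u

noncomputable def pentagonChain (a b c d e u v : V) : ZMod 2 :=
  edgeChain a b u v + edgeChain b c u v + edgeChain c d u v + edgeChain d e u v + edgeChain e a u v

omit [Fintype V] in
lemma pentagonChain_eq_zero_or {a b c d e : V} (u v : V) :
    pentagonChain a b c d e u v = 0 ∨ u = a ∧ (v = b ∨ v = e) ∨ u = b ∧ (v = a ∨ v = c) ∨
      u = c ∧ (v = b ∨ v = d) ∨ u = d ∧ (v = c ∨ v = e) ∨ u = e ∧ (v = a ∨ v = d) := by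
  by_contra! h
  apply h.1
  simp only [pentagonChain, edgeChain, Sym2.eq_iff]
  repeat rw [if_neg (by tauto)]
  simp

lemma isEvenChain_pentagonChain {G : SimpleGraph V} {a b c d e : V} (hab : G.Adj a b)
    (hbc : G.Adj b c) (hcd : G.Adj c d) (hde : G.Adj d e) (hea : G.Adj e a) :
    IsEvenChain G (pentagonChain a b c d e) where
  symm u v := by simp only [pentagonChain, edgeChain_symm _ _ u v]
  eq_zero u v h := by
    have : ∀ x y, G.Adj x y → edgeChain x y u v = 0 := by
      intro x y hxy
      rw [edgeChain, if_neg]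
      intro he
      apply h
      rwa [← SimpleGraph.mem_edgeSet, he, SimpleGraph.mem_edgeSet]
    simp [pentagonChain, this _ _ hab, this _ _ hbc, this _ _ hcd, this _ _ hde, this _ _ hea]
  sum_eq_zero u := by
    simp only [pentagonChain, sum_add_distrib, sum_edgeChain hab.ne, sum_edgeChain hbc.ne,
      sum_edgeChain hcd.ne, sum_edgeChain hde.ne, sum_edgeChain hea.ne]
    generalize (if u = a then (1 : ZMod 2) else 0) = x1
    generalize (if u = b then (1 : ZMod 2) else 0) = x2
    generalize (if u = c then (1 : ZMod 2) else 0) = x3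
    generalize (if u = d then (1 : ZMod 2) else 0) = x4
    generalize (if u = e then (1 : ZMod 2) else 0) = x5
    revert x1 x2 x3 x4 x5
    decide

/-- A potential for an even chain can be normalised to vanish at a given face. -/
lemma IsFacial.exists_eq_zero_at {Φ : Type} {G : SimpleGraph V} {l : V → V → Φ}
    (hl : IsFacial G l) {z : V → V → ZMod 2} (hz : IsEvenChain G z) (f : Φ) :
    ∃ w, w f = 0 ∧ z = faceBoundary G l w := by
  obtain ⟨w, rfl⟩ := hl.exists_eq z hz
  refine ⟨fun x => w x + w f, CharTwo.add_self_eq_zero _, ?_⟩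
  ext1 u; ext1 v
  unfold faceBoundary
  split_ifs
  · beta_reduce
    generalize w (l u v) = x, w (l v u) = y, w f = t
    revert x y t; decide
  · rfl

/-- Opposite corners of a quadrangular face cannot be joined by disjoint paths. -/
lemma IsFourFace.not_both_paths {Φ : Type} {G : SimpleGraph V} {l : V → V → Φ}
    (hl : IsFacial G l) (htf : ∀ x y z, G.Adj x y → G.Adj y z → ¬ G.Adj x z) {f : Φ}
    {a b c d y₁ y₂ z₁ z₂ : V} (hf : IsFourFace G l f a b c d)
    (h1 : G.Adj a y₁) (h2 : G.Adj y₁ y₂) (h3 : G.Adj y₂ c)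
    (h4 : G.Adj b z₁) (h5 : G.Adj z₁ z₂) (h6 : G.Adj z₂ d) : False := by
  obtain ⟨hab, hbc, hcd, hda, hac, hbd, hiff⟩ := hf
  obtain ⟨T, hT0, hT⟩ := hl.exists_eq_zero_at
    (isEvenChain_pentagonChain hab hbc h3.symm h2.symm h1.symm) f
  obtain ⟨U, hU0, hU⟩ := hl.exists_eq_zero_at
    (isEvenChain_pentagonChain hbc hcd h6.symm h5.symm h4.symm) f
  have n1 : y₁ ≠ b := by rintro rfl; exact htf _ _ _ h2 h3 hbc
  have n2 : y₁ ≠ d := by rintro rfl; exact htf _ _ _ h2 h3 hcd.symm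
  have n3 : y₁ ≠ c := by rintro rfl; exact htf _ _ _ hab hbc h1
  have n4 : y₂ ≠ a := by rintro rfl; exact htf _ _ _ hab hbc h3
  have n5 : y₂ ≠ b := by rintro rfl; exact htf _ _ _ h1 h2 hab
  have n6 : y₂ ≠ d := by rintro rfl; exact htf _ _ _ h1 h2 hda.symm
  have m1 : z₁ ≠ a := by rintro rfl; exact htf _ _ _ h5 h6 hda.symm
  have m2 : z₁ ≠ c := by rintro rfl; exact htf _ _ _ h5 h6 hcd
  have m4 : z₂ ≠ a := by rintro rfl; exact htf _ _ _ h4 h5 hab.symm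
  have m5 : z₂ ≠ c := by rintro rfl; exact htf _ _ _ h4 h5 hbc
  have k1 : y₁ ≠ z₁ := by rintro rfl; exact htf _ _ _ h1 h4.symm hab
  have k2 : y₁ ≠ z₂ := by rintro rfl; exact htf _ _ _ h1 h6 hda.symm
  have k3 : y₂ ≠ z₁ := by rintro rfl; exact htf _ _ _ h3.symm h4.symm hbc.symm
  have k4 : y₂ ≠ z₂ := by rintro rfl; exact htf _ _ _ h3.symm h6 hcd
  set D := faceBoundary G l (fun x => T x * U x) with hD
  have hDe := hl.isEvenChain (fun x => T x * U x)
  rw [← hD] at hDe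
  have zero : ∀ u v, pentagonChain a b c y₂ y₁ u v = 0 → pentagonChain b c d z₂ z₁ u v = 0 →
      D u v = 0 := by
    intro u v
    rw [hT, hU, hD]
    unfold faceBoundary
    split_ifs
    · simp only
      generalize T (l u v) = x, T (l v u) = y, U (l u v) = s, U (l v u) = t
      revert x y s t; decide
    · simp
  have prod : ∀ u v, G.Adj u v → (s(u, v) = s(a, b) ∨ s(u, v) = s(b, c) ∨ s(u, v) = s(c, d) ∨
      s(u, v) = s(d, a)) →
      D u v = pentagonChain a b c y₂ y₁ u v * pentagonChain b c d z₂ z₁ u v := by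
    intro u v huv he
    rw [hiff u v huv] at he
    rw [hT, hU, hD]
    simp only [faceBoundary_of_adj _ _ huv]
    by_cases hu : l u v = f
    · simp [hu, hT0, hU0]
    · have : l v u = f := by tauto
      simp [this, hT0, hU0]
  have single : ∀ u v, (∀ x, x ≠ v → D u x = 0) → D u v = 0 := by
    intro u v h
    rw [← hDe.sum_eq_zero u]
    exact (sum_eq_single v (fun x _ hx => h x hx) (by simp)).symm
  have nab := hab.ne
  have nbc := hbc.ne
  have ncd := hcd.ne
  have nda := hda.ne
  have r1 := h1.ne
  have r2 := h2.ne
  have r3 := h3.ne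
  have r4 := h4.ne
  have r6 := h6.ne
  have m6 : z₂ ≠ b := by rintro rfl; exact htf _ _ _ hbc hcd h6
  have m7 : z₁ ≠ d := by rintro rfl; exact htf _ _ _ hbc hcd h4
  have P : ∀ u v, pentagonChain a b c y₂ y₁ u v = 0 ∨ u = a ∧ (v = b ∨ v = y₁) ∨
      u = b ∧ (v = a ∨ v = c) ∨ u = c ∧ (v = b ∨ v = y₂) ∨ u = y₂ ∧ (v = c ∨ v = y₁) ∨
      u = y₁ ∧ (v = a ∨ v = y₂) := pentagonChain_eq_zero_or
  have Q : ∀ u v, pentagonChain b c d z₂ z₁ u v = 0 ∨ u = b ∧ (v = c ∨ v = z₁) ∨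
      u = c ∧ (v = b ∨ v = d) ∨ u = d ∧ (v = c ∨ v = z₂) ∨ u = z₂ ∧ (v = d ∨ v = z₁) ∨
      u = z₁ ∧ (v = b ∨ v = z₂) := pentagonChain_eq_zero_or
  have Dab : D a b = 0 := by
    have : pentagonChain b c d z₂ z₁ a b = 0 := by grind
    rw [prod _ _ hab (by simp), this, mul_zero]
  have d1 : D a y₁ = 0 := by
    refine single _ _ fun x hx => ?_
    by_cases hxb : x = b
    · rw [hxb, Dab]
    · by_cases hxd : x = d
      · have : pentagonChain a b c y₂ y₁ a d = 0 := by grind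
        rw [hxd, prod _ _ hda.symm (by simp), this, zero_mul]
      · apply zero <;> grind
  have d2 : D y₁ y₂ = 0 := by
    refine single _ _ fun x hx => ?_
    by_cases hxa : x = a
    · rw [hxa, hDe.symm, d1]
    · apply zero <;> grind
  have d3 : D y₂ c = 0 := by
    refine single _ _ fun x hx => ?_
    by_cases hxa : x = y₁
    · rw [hxa, hDe.symm, d2]
    · apply zero <;> grind
  have d4 : D c b = 0 := by
    refine single _ _ fun x hx => ?_
    by_cases hxy : x = y₂
    · rw [hxy, hDe.symm, d3]
    · by_cases hxd : x = d
      · have : pentagonChain a b c y₂ y₁ c d = 0 := by grind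
        rw [hxd, prod _ _ hcd (by simp), this, zero_mul]
      · apply zero <;> grind
  rw [prod _ _ hbc.symm (by simp)] at d4
  have e1 : pentagonChain a b c y₂ y₁ c b = 1 := by
    simp only [pentagonChain, edgeChain, Sym2.eq_iff]
    simp [hac.symm, nbc, nbc.symm, n1.symm, n5.symm, nab.symm]
  have e2 : pentagonChain b c d z₂ z₁ c b = 1 := by
    simp only [pentagonChain, edgeChain, Sym2.eq_iff]
    simp [nbc.symm]
    grind
  rw [e1, e2] at d4
  exact one_ne_zero d4

end facial

section contract

variable {V : Type u}

/-- Identify the vertex `q` with `p`; afterwards `q` is isolated. -/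
def contract (G : SimpleGraph V) (p q : V) : SimpleGraph V where
  Adj a b := a ≠ b ∧ a ≠ q ∧ b ≠ q ∧ (G.Adj a b ∨ a = p ∧ G.Adj q b ∨ b = p ∧ G.Adj q a)
  symm := ⟨fun a b h => by
    obtain ⟨h1, h2, h3, h4⟩ := h
    refine ⟨h1.symm, h3, h2, ?_⟩
    rw [G.adj_comm b a]; tauto⟩
  loopless := ⟨fun _ h => h.1 rfl⟩

/-- The pushforward of an edge chain to the contracted graph. -/
noncomputable def pushChain (p q : V) (z : V → V → ZMod 2) (u v : V) : ZMod 2 :=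
  if u = q ∨ v = q then 0 else
    z u v + (if u = p then z q v else 0) + if v = p then z u q else 0

section

variable {p q : V} {z : V → V → ZMod 2}

lemma pushChain_left (hpq : p ≠ q) (hd : ∀ u, z u u = 0)
    (h0 : z p q = 0) (v : V) : pushChain p q z p v = z p v + z q v := by
  by_cases hv : v = q
  · simp [pushChain, hv, h0, hd]
  · by_cases hvp : v = p
    · simp [pushChain, hvp, hpq, h0]
    · simp [pushChain, hpq, hv, hvp]

lemma pushChain_comm (hs : ∀ u v, z u v = z v u) (u v : V) :
    pushChain p q z u v = pushChain p q z v u := by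
  simp only [pushChain, hs u v, hs u q, hs q v, or_comm (a := u = q)]
  split_ifs <;> ring

lemma pushChain_add (z y : V → V → ZMod 2) (u v : V) :
    pushChain p q (fun u v => z u v + y u v) u v = pushChain p q z u v + pushChain p q y u v := by
  simp only [pushChain]
  split_ifs <;> ring

lemma sum_pushChain [Fintype V] (hpq : p ≠ q) (hd : ∀ u, z u u = 0)
    (h0 : z p q = 0) (u : V) : ∑ v, pushChain p q z u v =
      if u = q then 0 else if u = p then ∑ v, z p v + ∑ v, z q v else ∑ v, z u v := by
  split_ifs with h1 h2
  · simp [pushChain, h1]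
  · rw [h2, ← sum_add_distrib]
    exact sum_congr rfl fun v _ => pushChain_left hpq hd h0 v
  · have : ∀ v, pushChain p q z u v =
        z u v + ((if v = p then z u q else 0) + if v = q then z u q else 0) := by
      intro v
      by_cases hv : v = q
      · simp [pushChain, hv, hpq.symm, CharTwo.add_self_eq_zero]
      · simp [pushChain, h1, h2, hv]
    simp [this, sum_add_distrib, CharTwo.add_self_eq_zero]

end

variable [Fintype V] {Φ : Type} {G : SimpleGraph V} {l : V → V → Φ} {f : Φ} {a b c d : V}

/-- The face across the dart `(u, v)` from `f`. -/
noncomputable def oppositeFace (l : V → V → Φ) (f : Φ) (u v : V) : Φ :=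
  if l u v = f then l v u else l u v

omit [Fintype V] in
lemma IsFourFace.faceBoundary_eq (hf : IsFourFace G l f a b c d) (w : Φ → ZMod 2) {u v : V}
    (huv : G.Adj u v) (h : s(u, v) = s(a, b) ∨ s(u, v) = s(b, c) ∨ s(u, v) = s(c, d) ∨
    s(u, v) = s(d, a)) : faceBoundary G l w u v = w f + w (oppositeFace l f u v) := by
  rw [faceBoundary_of_adj _ _ huv, oppositeFace]
  have := (hf.iff_ne u v huv).1 h
  split_ifs with h1
  · rw [h1]
  · have h2 : l v u = f := by tauto
    rw [h2, add_comm]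

/-- The faces of the graph obtained by identifying two opposite vertices of the face
`a b c d`. -/
noncomputable def contractFace (G : SimpleGraph V) (l : V → V → Φ) (f : Φ) (a b c d u v : V) : Φ :=
  if u = a then
    if v = b ∨ v = d then oppositeFace l f a v else if G.Adj a v then l a v else l c v
  else if v = a then
    if u = b ∨ u = d then oppositeFace l f c u else if G.Adj a u then l u a else l u c
  else l u v

omit [Fintype V] in
lemma faceBoundary_contractFace (hf : IsFourFace G l f a b c d) (hac : ¬ G.Adj a c)
    (hcom : ∀ x, G.Adj a x → G.Adj c x → x = b ∨ x = d) (w : Φ → ZMod 2) (u v : V) :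
    faceBoundary (contract G a c) (contractFace G l f a b c d) w u v =
      pushChain a c (faceBoundary G l w) u v := by
  have hs := faceBoundary_symm G l w
  have hd : ∀ u, faceBoundary G l w u u = 0 := fun u => faceBoundary_of_not_adj l w (by simp)
  have h0 : faceBoundary G l w a c = 0 := faceBoundary_of_not_adj l w hac
  have key : ∀ v, faceBoundary (contract G a c) (contractFace G l f a b c d) w a v =
      pushChain a c (faceBoundary G l w) a v := by
    intro v
    rw [pushChain_left hf.ne_ac hd h0]
    by_cases hva : v = a
    · rw [hva, faceBoundary_of_not_adj _ _ (by simp), hd, hs c a, h0, add_zero]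
    by_cases hvc : v = c
    · rw [hvc, faceBoundary_of_not_adj _ _ (by simp [contract]), hd, h0, add_zero]
    by_cases hv : v = b ∨ v = d
    · have h1 : G.Adj a v ∧ G.Adj c v := by
        rcases hv with rfl | rfl
        · exact ⟨hf.adj_ab, hf.adj_bc.symm⟩
        · exact ⟨hf.adj_da.symm, hf.adj_cd⟩
      rw [faceBoundary_of_adj (G := contract G a c) _ _ ⟨Ne.symm hva, hf.ne_ac, hvc, Or.inl h1.1⟩,
        hf.faceBoundary_eq w h1.1 (by rcases hv with rfl | rfl <;> simp),
        hf.faceBoundary_eq w h1.2 (by rcases hv with rfl | rfl <;> simp)]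
      simp only [contractFace, if_pos hv, if_neg hva, if_true]
      generalize w f = x, w (oppositeFace l f a v) = y, w (oppositeFace l f c v) = t
      revert x y t; decide
    by_cases h1 : G.Adj a v
    · have h2 : ¬ G.Adj c v := fun h => hv (hcom v h1 h)
      rw [faceBoundary_of_adj (G := contract G a c) _ _ ⟨Ne.symm hva, hf.ne_ac, hvc, Or.inl h1⟩,
        faceBoundary_of_adj _ _ h1, faceBoundary_of_not_adj _ _ h2]
      simp [contractFace, hv, hva, h1]
    · rw [faceBoundary_of_not_adj _ _ h1, zero_add]
      by_cases h2 : G.Adj c v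
      · rw [faceBoundary_of_adj (G := contract G a c) _ _
          ⟨Ne.symm hva, hf.ne_ac, hvc, Or.inr (Or.inl ⟨rfl, h2⟩)⟩,
          faceBoundary_of_adj _ _ h2]
        simp [contractFace, hv, hva, h1]
      · rw [faceBoundary_of_not_adj _ _ h2, faceBoundary_of_not_adj]
        simp [contract, h1, h2, hva]
  by_cases hu : u = a
  · rw [hu, key]
  by_cases hv : v = a
  · rw [hv, faceBoundary_symm, key, pushChain_comm hs]
  by_cases huc : u = c
  · rw [faceBoundary_of_not_adj _ _ (by simp [contract, huc]), pushChain, if_pos (Or.inl huc)]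
  by_cases hvc : v = c
  · rw [faceBoundary_of_not_adj _ _ (by simp [contract, hvc]), pushChain, if_pos (Or.inr hvc)]
  have hadj : (contract G a c).Adj u v ↔ G.Adj u v := by
    have := fun h : G.Adj u v => h.ne
    simp only [contract]
    tauto
  rw [pushChain, if_neg (by tauto), if_neg hu, if_neg hv, add_zero, add_zero]
  simp only [faceBoundary, hadj, contractFace, if_neg hu, if_neg hv]

/-- Lift an edge chain from the contracted graph. -/
noncomputable def liftChain (a c : V) (R : V → Prop) (z : V → V → ZMod 2) (u v : V) : ZMod 2 :=
  if u = c then if R v then z a v else 0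
  else if v = c then if R u then z a u else 0
  else if u = a then if R v then 0 else z a v
  else if v = a then if R u then 0 else z a u
  else z u v

omit [Fintype V] in
lemma liftChain_comm {R : V → Prop} {z : V → V → ZMod 2} (hR : ∀ v, R v → v ≠ c ∧ v ≠ a)
    (hs : ∀ u v, z u v = z v u) (u v : V) : liftChain a c R z u v = liftChain a c R z v u := by
  unfold liftChain
  grind

omit [Fintype V] in
lemma pushChain_liftChain {R : V → Prop} {z : V → V → ZMod 2} (hac : a ≠ c)
    (hR : ∀ v, R v → v ≠ c ∧ v ≠ a)
    (hs : ∀ u v, z u v = z v u) (hz : ∀ v, z c v = 0) (hd : ∀ v, z v v = 0) (u v : V) :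
    pushChain a c (liftChain a c R z) u v = z u v := by
  have hs' := liftChain_comm hR hs
  have hd' : ∀ u, liftChain a c R z u u = 0 := by
    intro u; unfold liftChain; grind
  have h0 : liftChain a c R z a c = 0 := by unfold liftChain; grind
  have key : ∀ v, pushChain a c (liftChain a c R z) a v = z a v := by
    intro v
    rw [pushChain_left hac hd' h0]
    unfold liftChain
    grind
  by_cases hu : u = a
  · rw [hu, key]
  by_cases hv : v = a
  · rw [hv, pushChain_comm hs', key, hs]
  unfold pushChain liftChain
  grind

lemma isFacial_contract_aux (hl : IsFacial G l) (hf : IsFourFace G l f a b c d)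
    (hac : ¬ G.Adj a c) (hcom : ∀ x, G.Adj a x → G.Adj c x → x = b ∨ x = d) :
    IsFacial (contract G a c) (contractFace G l f a b c d) where
  sum_faceBoundary w u := by
    simp only [faceBoundary_contractFace hf hac hcom]
    rw [sum_pushChain (z := faceBoundary G l w) hf.ne_ac
      (fun u => faceBoundary_of_not_adj l w (by simp)) (faceBoundary_of_not_adj l w hac)]
    simp [hl.sum_faceBoundary]
  exists_eq z hz := by
    have hca := hf.ne_ac
    set R : V → Prop := fun v => G.Adj c v ∧ v ≠ b ∧ v ≠ d with hRdef
    have hR : ∀ v, R v → v ≠ c ∧ v ≠ a := by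
      rintro v ⟨h, -⟩
      refine ⟨h.ne', ?_⟩
      rintro rfl
      exact hac h.symm
    have hzc : ∀ v, z c v = 0 := fun v => hz.eq_zero _ _ (by simp [contract])
    have hzd : ∀ v, z v v = 0 := fun v => hz.eq_zero _ _ (by simp)
    set y := liftChain a c R z with hy
    have hys : ∀ u v, y u v = y v u := liftChain_comm hR hz.symm
    have hpy : ∀ u v, pushChain a c y u v = z u v :=
      pushChain_liftChain hca hR hz.symm hzc hzd
    have hyG : ∀ u v, ¬ G.Adj u v → y u v = 0 := by
      intro u v huv
      have h1 : ∀ v, ¬ G.Adj a v → ¬ R v → z a v = 0 := by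
        intro v hv hRv
        refine hz.eq_zero _ _ ?_
        rintro ⟨-, -, h3, h4 | ⟨-, h4⟩ | ⟨rfl, h4⟩⟩
        · exact hv h4
        · have : v = b ∨ v = d := by
            by_contra! h; exact hRv ⟨h4, h⟩
          rcases this with rfl | rfl
          · exact hv hf.adj_ab
          · exact hv hf.adj_da.symm
        · exact hac h4.symm
      rw [hy]
      unfold liftChain
      split_ifs with h2 h3 h4 h5 h6 h7 h8 h9
      · exact absurd (h2 ▸ h3.1) huv
      · rfl
      · exact absurd (h4 ▸ h5.1.symm) huv
      · rfl
      · rfl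
      · exact h1 v (h6 ▸ huv) h7
      · rfl
      · exact h1 u (fun h => huv (h8 ▸ h.symm)) h9
      · exact hz.eq_zero _ _ (by
          rintro ⟨-, -, -, h | ⟨h, -⟩ | ⟨h, -⟩⟩
          · exact huv h
          · exact h6 h
          · exact h8 h)
    have hrow := fun u => sum_pushChain hca (fun u => hyG u u (by simp)) (hyG a c hac) u
    simp only [hpy, hz.sum_eq_zero] at hrow
    have hab := hf.adj_ab
    have hbc := hf.adj_bc
    set e : V → V → ZMod 2 := fun u v => edgeChain a b u v + edgeChain b c u v with he
    have hes : ∀ u v, e u v = e v u := by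
      intro u v; simp only [he, edgeChain_symm _ _ u v]
    have heG : ∀ u v, ¬ G.Adj u v → e u v = 0 := by
      intro u v huv
      have : ∀ x y, G.Adj x y → edgeChain x y u v = 0 := by
        intro x y hxy
        rw [edgeChain, if_neg]
        intro he
        apply huv
        rwa [← SimpleGraph.mem_edgeSet, he, SimpleGraph.mem_edgeSet]
      simp only [he, this _ _ hab, this _ _ hbc, add_zero]
    have hpe : ∀ u v, pushChain a c e u v = 0 := by
      have hk : ∀ v, pushChain a c e a v = 0 := by
        intro v
        rw [pushChain_left hca (fun u => heG u u (by simp)) (heG a c hac)]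
        have := hab.ne
        have := hbc.ne
        simp only [he, edgeChain, Sym2.eq_iff]
        by_cases hv : v = b
        · subst hv
          simp [hca, hca.symm, hbc.ne', hab.ne, CharTwo.add_self_eq_zero]
        · simp [hca, hca.symm, hab.ne, hbc.ne', hv]
      intro u v
      by_cases hu : u = a
      · rw [hu, hk]
      by_cases hv : v = a
      · rw [hv, pushChain_comm hes, hk]
      unfold pushChain
      simp only [he, edgeChain, Sym2.eq_iff]
      grind
    set α := ∑ v, y c v with hα
    have hzz : IsEvenChain G fun u v => y u v + α * e u v := by
      refine ⟨fun u v => ?_, fun u v h => ?_, fun u => ?_⟩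
      · simp only [hys u v, hes u v]
      · simp only [hyG u v h, heG u v h, mul_zero, add_zero]
      · simp only [sum_add_distrib, ← mul_sum, he, sum_edgeChain hab.ne, sum_edgeChain hbc.ne]
        have := hrow u
        by_cases huc : u = c
        · rw [huc, ← hα]
          simp [hca.symm, hbc.ne', CharTwo.add_self_eq_zero]
        rw [if_neg huc] at this
        by_cases hua : u = a
        · rw [if_pos hua] at this
          rw [hua]
          simp [hca, hab.ne, ← this]
        · rw [if_neg hua] at this
          rw [← this]
          simp [huc, hua, CharTwo.add_self_eq_zero]
    obtain ⟨w, hw⟩ := hl.exists_eq _ hzz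
    refine ⟨w, ?_⟩
    ext1 u; ext1 v
    rw [faceBoundary_contractFace hf hac hcom, ← hw, pushChain_add, hpy]
    have : pushChain a c (fun u v => α * e u v) u v = α * pushChain a c e u v := by
      simp only [pushChain]
      split_ifs <;> ring
    rw [this, hpe, mul_zero, add_zero]

lemma IsFourFace.macLanePlanar_contract (hl : IsFacial G l) (hf : IsFourFace G l f a b c d)
    (hac : ¬ G.Adj a c) : MacLanePlanar (contract G a c) := by
  let H : SimpleGraph V :=
    { Adj := fun x y => G.Adj x y ∧ ¬ (x = c ∧ G.Adj a y ∧ y ≠ b ∧ y ≠ d) ∧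
        ¬ (y = c ∧ G.Adj a x ∧ x ≠ b ∧ x ≠ d)
      symm := ⟨fun x y h => ⟨h.1.symm, h.2.2, h.2.1⟩⟩
      loopless := ⟨fun x h => h.1.ne rfl⟩ }
  have hHG : H ≤ G := fun _ _ h => h.1
  have hH : IsFourFace H (mergedFace G H l) (Quot.mk _ f) a b c d := by
    have := hf.ne_ac
    refine hf.restrict hHG ⟨hf.adj_ab, ?_⟩ ⟨hf.adj_bc, ?_⟩ ⟨hf.adj_cd, ?_⟩ ⟨hf.adj_da, ?_⟩ <;>
      grind [SimpleGraph.Adj.ne, hf.adj_bc, hf.adj_cd]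
  have heq : contract H a c = contract G a c := by
    ext x y
    simp only [contract, H]
    have := fun x => G.adj_comm x c
    have := fun x => G.adj_comm x a
    grind
  rw [← heq]
  refine ⟨_, _, isFacial_contract_aux (hl.restrict hHG) hH (fun h => hac h.1) ?_⟩
  rintro x ⟨h1, -⟩ ⟨-, h2, -⟩
  by_contra! h
  exact h2 ⟨rfl, h1, h⟩

end contract

section euler

variable {V : Type u} [Fintype V]

/-- The edges on which a symmetric edge chain does not vanish. -/
noncomputable def chainEdges (z : V → V → ZMod 2) : Finset (Sym2 V) :=
  {e | ∃ u v, e = s(u, v) ∧ z u v ≠ 0}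

lemma mem_chainEdges {z : V → V → ZMod 2} (hs : ∀ u v, z u v = z v u) {u v : V} :
    s(u, v) ∈ chainEdges z ↔ z u v ≠ 0 := by
  simp only [chainEdges, mem_filter, mem_univ, true_and, Sym2.eq_iff]
  constructor
  · rintro ⟨x, y, ⟨rfl, rfl⟩ | ⟨rfl, rfl⟩, h⟩
    · exact h
    · rwa [hs]
  · exact fun h => ⟨u, v, Or.inl ⟨rfl, rfl⟩, h⟩

lemma IsEvenChain.exists_ne {G : SimpleGraph V} {z : V → V → ZMod 2} (hz : IsEvenChain G z)
    {u v : V} (h : z u v ≠ 0) : ∃ x, x ≠ v ∧ z u x ≠ 0 := by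
  by_contra! hx
  apply h
  rw [← hz.sum_eq_zero u]
  exact (sum_eq_single v (fun x _ hxv => hx x hxv) (by simp)).symm

lemma IsEvenChain.five_le_card_or {G : SimpleGraph V} {z : V → V → ZMod 2} (hz : IsEvenChain G z)
    (htf : ∀ x y z, G.Adj x y → G.Adj y z → ¬ G.Adj x z) (hne : z ≠ 0) :
    5 ≤ #(chainEdges z) ∨ ∃ a b c d, G.Adj a b ∧ G.Adj b c ∧ G.Adj c d ∧ G.Adj d a ∧ a ≠ c ∧
      b ≠ d ∧ ∀ u v, s(u, v) = s(a, b) ∨ s(u, v) = s(b, c) ∨ s(u, v) = s(c, d) ∨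
        s(u, v) = s(d, a) ↔ z u v ≠ 0 := by
  have hadj : ∀ {u v}, z u v ≠ 0 → G.Adj u v := fun {u v} h => by
    by_contra hn; exact h (hz.eq_zero u v hn)
  have card5 : ∀ e₁ e₂ e₃ e₄ e₅ : Sym2 V, e₁ ∈ chainEdges z → e₂ ∈ chainEdges z →
      e₃ ∈ chainEdges z → e₄ ∈ chainEdges z → e₅ ∈ chainEdges z → [e₁, e₂, e₃, e₄, e₅].Nodup →
      5 ≤ #(chainEdges z) := by
    intro e₁ e₂ e₃ e₄ e₅ h₁ h₂ h₃ h₄ h₅ hn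
    refine (List.toFinset_card_of_nodup hn).symm.le.trans (card_le_card fun e he => ?_)
    simp only [List.mem_toFinset, List.mem_cons, List.not_mem_nil, or_false] at he
    rcases he with rfl | rfl | rfl | rfl | rfl <;> assumption
  obtain ⟨a, b, hab⟩ : ∃ a b, z a b ≠ 0 := by
    by_contra! h; exact hne (by ext1 u; ext1 v; exact h u v)
  have hba : z b a ≠ 0 := by rwa [hz.symm]
  obtain ⟨c, hca, hbc⟩ := hz.exists_ne hba
  obtain ⟨d, hdb, had⟩ := hz.exists_ne hab
  have hcd : c ≠ d := by
    rintro rfl; exact htf _ _ _ (hadj hab) (hadj hbc) (hadj had)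
  have n1 := (hadj hab).ne
  have n2 := (hadj hbc).ne
  have n3 := (hadj had).ne
  have m1 := (mem_chainEdges hz.symm).2 hab
  have m2 := (mem_chainEdges hz.symm).2 hbc
  have m3 := (mem_chainEdges hz.symm).2 had
  by_cases hz4 : z c d = 0
  · left
    have hcb : z c b ≠ 0 := by rwa [hz.symm]
    have hda : z d a ≠ 0 := by rwa [hz.symm]
    obtain ⟨x, hxb, hcx⟩ := hz.exists_ne hcb
    obtain ⟨y, hya, hdy⟩ := hz.exists_ne hda
    have hxd : x ≠ d := by rintro rfl; exact hcx hz4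
    have hyc : y ≠ c := by rintro rfl; exact hdy (by rwa [hz.symm])
    have hxa : x ≠ a := by
      rintro rfl; exact htf _ _ _ (hadj hab) (hadj hbc) (hadj hcx).symm
    have n4 := (hadj hcx).ne
    have n5 := (hadj hdy).ne
    refine card5 _ _ _ _ _ m1 m2 m3 ((mem_chainEdges hz.symm).2 hcx)
      ((mem_chainEdges hz.symm).2 hdy) ?_
    simp only [List.nodup_cons, List.mem_cons, List.not_mem_nil, or_false, Sym2.eq_iff, not_or]
    grind
  · by_cases hall : ∀ u v, s(u, v) = s(a, b) ∨ s(u, v) = s(b, c) ∨ s(u, v) = s(c, d) ∨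
        s(u, v) = s(d, a) ↔ z u v ≠ 0
    · exact Or.inr ⟨a, b, c, d, hadj hab, hadj hbc, hadj hz4, (hadj had).symm, hca.symm,
        hdb.symm, hall⟩
    left
    have m4 := (mem_chainEdges hz.symm).2 hz4
    have m3' : s(d, a) ∈ chainEdges z := by rwa [Sym2.eq_swap]
    simp only [not_forall] at hall
    obtain ⟨u, v, huv⟩ := hall
    have h1 : s(u, v) = s(a, b) ∨ s(u, v) = s(b, c) ∨ s(u, v) = s(c, d) ∨
        s(u, v) = s(d, a) → z u v ≠ 0 := by
      rw [← mem_chainEdges hz.symm]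
      rintro (h | h | h | h) <;> rw [h] <;> assumption
    have h2 : z u v ≠ 0 := by tauto
    refine card5 _ _ _ _ _ m1 m2 m4 m3' ((mem_chainEdges hz.symm).2 h2) ?_
    have h3 : ¬ (s(u, v) = s(a, b) ∨ s(u, v) = s(b, c) ∨ s(u, v) = s(c, d) ∨
        s(u, v) = s(d, a)) := fun h => huv ⟨h1, fun _ => h⟩
    simp only [not_or] at h3
    have e1 := Ne.symm h3.1
    have e2 := Ne.symm h3.2.1
    have e3 := Ne.symm h3.2.2.1
    have e4 := Ne.symm h3.2.2.2
    simp only [List.nodup_cons, List.mem_cons, List.not_mem_nil, or_false, not_or]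
    refine ⟨⟨?_, ?_, ?_, e1⟩, ⟨?_, ?_, e2⟩, ⟨?_, e3⟩, e4, by simp⟩ <;>
      simp only [Sym2.eq_iff] <;> grind

/-- The edge chain associated with a function on the edge set. -/
noncomputable def toChain (G : SimpleGraph V) :
    (G.edgeSet → ZMod 2) →ₗ[ZMod 2] (V → V → ZMod 2) where
  toFun x u v := if h : G.Adj u v then x ⟨s(u, v), h⟩ else 0
  map_add' x y := by
    ext1 u; ext1 v
    simp only [Pi.add_apply]
    split_ifs <;> simp
  map_smul' r x := by
    ext1 u; ext1 v
    simp only [Pi.smul_apply, RingHom.id_apply]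
    split_ifs <;> simp

omit [Fintype V] in
lemma toChain_injective (G : SimpleGraph V) : Function.Injective (toChain G) := by
  intro x y h
  ext ⟨e, he⟩
  induction e with
  | _ u v =>
    have := congrFun (congrFun h u) v
    rw [SimpleGraph.mem_edgeSet] at he
    simpa [toChain, he] using this

omit [Fintype V] in
lemma toChain_symm (G : SimpleGraph V) (x : G.edgeSet → ZMod 2) (u v : V) :
    toChain G x u v = toChain G x v u := by
  simp only [toChain, LinearMap.coe_mk, AddHom.coe_mk, G.adj_comm u v, Sym2.eq_swap (a := u)]

lemma sum_sum_eq_zero {α : Type*} {z : α → α → ZMod 2} (hs : ∀ u v, z u v = z v u)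
    (hd : ∀ u, z u u = 0) (s : Finset α) : ∑ u ∈ s, ∑ v ∈ s, z u v = 0 := by
  rw [← sum_product' (f := z)]
  refine sum_involution (fun p _ => p.swap) (fun p _ => ?_) (fun p _ h => ?_) ?_ (by simp)
  · simp only [Prod.fst_swap, Prod.snd_swap]
    rw [hs p.2, CharTwo.add_self_eq_zero]
  · intro he
    apply h
    have : p.2 = p.1 := congrArg Prod.fst he
    rw [this, hd]
  · intro p hp
    rw [mem_product] at hp ⊢
    exact hp.symm

/-- A lower bound for the dimension of the cycle space. -/
lemma card_edgeSet_le {G : SimpleGraph V} {A : Finset V} (hA : A.Nonempty)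
    (hGA : ∀ u v, G.Adj u v → u ∈ A) {B : Finset (V → V → ZMod 2)}
    (hB : ∀ z, IsEvenChain G z → z ∈ Submodule.span (ZMod 2) (B : Set (V → V → ZMod 2))) :
    Fintype.card G.edgeSet + 1 ≤ #A + #B := by
  obtain ⟨a₀, ha₀⟩ := hA
  let bd : (G.edgeSet → ZMod 2) →ₗ[ZMod 2] (↥(A.erase a₀) → ZMod 2) :=
    { toFun := fun x a => ∑ v, toChain G x a v
      map_add' := fun x y => by ext a; simp [sum_add_distrib]
      map_smul' := fun r x => by ext a; simp [mul_sum] }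
  have h1 := bd.finrank_range_add_finrank_ker
  have h2 : Module.finrank (ZMod 2) (LinearMap.range bd) ≤ #A - 1 := by
    refine (Submodule.finrank_le _).trans ?_
    rw [Module.finrank_fintype_fun_eq_card, Fintype.card_coe, card_erase_of_mem ha₀]
  have h3 : Module.finrank (ZMod 2) (LinearMap.ker bd) ≤ #B := by
    rw [(Submodule.equivMapOfInjective _ (toChain_injective G) (LinearMap.ker bd)).finrank_eq]
    refine le_trans (Submodule.finrank_mono ?_) (finrank_span_finset_le_card B)
    rintro _ ⟨x, hx, rfl⟩
    have hd : ∀ u, toChain G x u u = 0 := by intro u; simp [toChain]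
    have hout : ∀ u, u ≠ a₀ → ∑ v, toChain G x u v = 0 := by
      intro u hu
      by_cases huA : u ∈ A
      · have : bd x = 0 := hx
        exact congrFun this ⟨u, mem_erase.2 ⟨hu, huA⟩⟩
      · refine sum_eq_zero fun v _ => ?_
        have : ¬ G.Adj u v := fun h => huA (hGA u v h)
        simp [toChain, this]
    refine hB _ ⟨toChain_symm G x, fun u v h => by simp [toChain, h], fun u => ?_⟩
    by_cases hu : u = a₀
    · rw [hu, ← sum_sum_eq_zero (toChain_symm G x) hd univ]
      exact (sum_eq_single a₀ (fun u _ hu => hout u hu) (by simp)).symm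
    · exact hout u hu
  rw [Module.finrank_fintype_fun_eq_card] at h1
  have := card_pos.2 ⟨a₀, ha₀⟩
  omega

omit [Fintype V] in
lemma faceBoundary_eq_sum {Φ : Type} {G : SimpleGraph V} {l : V → V → Φ} {I : Finset Φ}
    (hI : ∀ u v, l u v ∈ I) (w : Φ → ZMod 2) :
    faceBoundary G l w = ∑ φ ∈ I, w φ • faceBoundary G l (Pi.single φ 1) := by
  ext1 u; ext1 v
  rw [Finset.sum_apply, Finset.sum_apply]
  simp only [Pi.smul_apply, smul_eq_mul]
  by_cases h : G.Adj u v
  · simp only [faceBoundary_of_adj _ _ h, mul_add, sum_add_distrib, Pi.single_apply, mul_ite,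
      mul_one, mul_zero, sum_ite_eq, hI, if_true]
  · simp [faceBoundary_of_not_adj _ _ h]

/-- Euler's inequality for triangle-free plane graphs without quadrangular faces. -/
lemma IsFacial.euler {Φ : Type} {G : SimpleGraph V} {l : V → V → Φ} (hl : IsFacial G l)
    (htf : ∀ x y z, G.Adj x y → G.Adj y z → ¬ G.Adj x z) {A : Finset V} (hA : A.Nonempty)
    (hGA : ∀ u v, G.Adj u v → u ∈ A) (h4 : ∀ f a b c d, ¬ IsFourFace G l f a b c d) :
    Fintype.card G.edgeSet + 1 ≤ #A ∨ 3 * Fintype.card G.edgeSet + 10 ≤ 5 * #A := by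
  set I : Finset Φ := univ.image fun p : V × V => l p.1 p.2 with hI
  have hlI : ∀ u v, l u v ∈ I := fun u v => mem_image.2 ⟨(u, v), mem_univ _, rfl⟩
  set bd : Φ → V → V → ZMod 2 := fun φ => faceBoundary G l (Pi.single φ 1) with hbd
  set J := I.filter fun φ => bd φ ≠ 0 with hJ
  have hsum : ∀ w, faceBoundary G l w = ∑ φ ∈ J, w φ • bd φ := by
    intro w
    rw [faceBoundary_eq_sum hlI w, hJ, sum_filter]
    refine sum_congr rfl fun φ _ => ?_
    split_ifs with h
    · rfl
    · rw [show faceBoundary G l (Pi.single φ 1) = 0 from not_not.1 h, smul_zero]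
  obtain hJ0 | ⟨φ₀, hφ₀⟩ := J.eq_empty_or_nonempty
  · left
    refine card_edgeSet_le (B := ∅) hA hGA fun z hz => ?_
    obtain ⟨w, rfl⟩ := hl.exists_eq z hz
    rw [hsum, hJ0]
    simp
  right
  have h1 := card_edgeSet_le (B := (J.erase φ₀).image bd) hA hGA fun z hz => by
    obtain ⟨w, hw, rfl⟩ := hl.exists_eq_zero_at hz φ₀
    rw [hsum, ← add_sum_erase _ _ hφ₀, hw, zero_smul, zero_add]
    exact Submodule.sum_mem _ fun φ hφ => Submodule.smul_mem _ _
      (Submodule.subset_span (mem_coe.2 (mem_image_of_mem _ hφ)))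
  have h2 : #((J.erase φ₀).image bd) + 1 ≤ #J := by
    rw [← card_erase_add_one hφ₀]
    exact Nat.add_le_add_right card_image_le 1
  have h5 : ∀ φ ∈ J, 5 ≤ #(chainEdges (bd φ)) := by
    intro φ hφ
    refine ((hl.isEvenChain _).five_le_card_or htf (mem_filter.1 hφ).2).resolve_right ?_
    rintro ⟨a, b, c, d, hab, hbc, hcd, hda, hac, hbd', hiff⟩
    refine h4 φ a b c d ⟨hab, hbc, hcd, hda, hac, hbd', fun u v huv => ?_⟩
    rw [hiff, faceBoundary_of_adj _ _ huv]
    by_cases h1 : l u v = φ <;> by_cases h2 : l v u = φ <;>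
      simp [h1, h2, CharTwo.add_self_eq_zero]
  have hsub : ∀ φ, chainEdges (bd φ) ⊆ G.edgeFinset := by
    intro φ e he
    induction e with
    | _ u v =>
      rw [mem_chainEdges (hl.isEvenChain _).symm] at he
      rw [SimpleGraph.mem_edgeFinset, SimpleGraph.mem_edgeSet]
      by_contra h
      exact he (faceBoundary_of_not_adj _ _ h)
  have h6 : 5 * #J ≤ ∑ φ ∈ J, #(chainEdges (bd φ)) := by
    rw [mul_comm, ← smul_eq_mul]
    exact card_nsmul_le_sum _ _ _ h5
  have h7 : ∑ φ ∈ J, #(chainEdges (bd φ)) ≤ 2 * #G.edgeFinset := by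
    have : ∀ φ ∈ J, #(chainEdges (bd φ)) =
        #(bipartiteAbove (fun φ e => e ∈ chainEdges (bd φ)) G.edgeFinset φ) := by
      intro φ _
      congr 1
      ext e
      simp only [bipartiteAbove, mem_filter]
      exact ⟨fun h => ⟨hsub φ h, h⟩, fun h => h.2⟩
    rw [sum_congr rfl this, sum_card_bipartiteAbove_eq_sum_card_bipartiteBelow, mul_comm,
      ← smul_eq_mul]
    refine sum_le_card_nsmul _ _ _ fun e _ => ?_
    induction e with
    | _ u v =>
      refine (card_le_card (t := {l u v, l v u}) fun φ hφ => ?_).trans card_le_two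
      have : s(u, v) ∈ chainEdges (bd φ) := (mem_filter.1 hφ).2
      rw [mem_chainEdges (hl.isEvenChain _).symm] at this
      by_contra hn
      simp only [mem_insert, mem_singleton, not_or] at hn
      apply this
      simp [faceBoundary, Ne.symm hn.1, Ne.symm hn.2]
  rw [SimpleGraph.edgeFinset_card] at h7
  omega

end euler

section coloring

variable {V : Type u} {G : SimpleGraph V}

lemma not_adj_of_adj_contract {a c : V} (htf : ∀ x y z, G.Adj x y → G.Adj y z → ¬ G.Adj x z)
    (hp : ∀ y₁ y₂, G.Adj a y₁ → G.Adj y₁ y₂ → ¬ G.Adj y₂ c) (x y z : V)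
    (hxy : (contract G a c).Adj x y) (hyz : (contract G a c).Adj y z) :
    ¬ (contract G a c).Adj x z := by
  have key : ∀ y z, G.Adj y z → (G.Adj a y ∨ G.Adj c y) → (G.Adj a z ∨ G.Adj c z) → False := by
    rintro y z h (h1 | h1) (h2 | h2)
    · exact htf _ _ _ h1 h h2
    · exact hp _ _ h1 h h2.symm
    · exact hp _ _ h2 h.symm h1.symm
    · exact htf _ _ _ h1 h h2
  have red : ∀ {x y}, (contract G a c).Adj x y → x ≠ a → y ≠ a → G.Adj x y := by
    rintro x y ⟨-, -, -, h | ⟨h, -⟩ | ⟨h, -⟩⟩ hx hy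
    · exact h
    · exact absurd h hx
    · exact absurd h hy
  have at_a : ∀ {y}, (contract G a c).Adj a y → G.Adj a y ∨ G.Adj c y := by
    rintro y ⟨h0, -, -, h | ⟨-, h⟩ | ⟨h, -⟩⟩
    · exact Or.inl h
    · exact Or.inr h
    · exact absurd h.symm h0
  intro hxz
  by_cases hx : x = a
  · subst hx
    exact key _ _ (red hyz hxy.ne' hxz.ne') (at_a hxy) (at_a hxz)
  by_cases hy : y = a
  · subst hy
    exact key _ _ (red hxz hx hyz.ne') (at_a hxy.symm) (at_a hyz)
  by_cases hz : z = a
  · subst hz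
    exact key _ _ (red hxy hx hy) (at_a hxz.symm) (at_a hyz.symm)
  exact htf _ _ _ (red hxy hx hy) (red hyz hy hz) (red hxz hx hz)

/-- Add a new vertex adjacent to all vertices of `S`. -/
def apexGraph (G : SimpleGraph V) (S : Finset V) : SimpleGraph (Option V) where
  Adj x y := (∃ u v, x = some u ∧ y = some v ∧ G.Adj u v) ∨ (x = none ∧ ∃ s ∈ S, y = some s) ∨
    (y = none ∧ ∃ s ∈ S, x = some s)
  symm := ⟨by
    rintro x y (⟨u, v, hx, hy, h⟩ | h | h)
    · exact Or.inl ⟨v, u, hy, hx, h.symm⟩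
    · exact Or.inr (Or.inr h)
    · exact Or.inr (Or.inl h)⟩
  loopless := ⟨by
    rintro x (⟨u, v, hx, hy, h⟩ | ⟨rfl, s, -, h⟩ | ⟨rfl, s, -, h⟩)
    · exact h.ne (Option.some_injective _ (hx.symm.trans hy))
    · cases h
    · cases h⟩

@[simp] lemma apexGraph_some_some (S : Finset V) (u v : V) :
    (apexGraph G S).Adj (some u) (some v) ↔ G.Adj u v := by
  simp [apexGraph]

@[simp] lemma apexGraph_none_some (S : Finset V) (v : V) :
    (apexGraph G S).Adj none (some v) ↔ v ∈ S := by
  simp [apexGraph]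

@[simp] lemma apexGraph_some_none (S : Finset V) (v : V) :
    (apexGraph G S).Adj (some v) none ↔ v ∈ S := by
  simp [apexGraph]

/-- A proper colouring in which the vertices of `S` avoid the colour `2`. -/
def AvoidingColorable (G : SimpleGraph V) (S : Finset V) : Prop :=
  ∃ φ : V → Fin 3, (∀ u v, G.Adj u v → φ u ≠ φ v) ∧ ∀ s ∈ S, φ s ≠ 2

lemma AvoidingColorable.colorableOn {S : Finset V} {W : Finset (Option V)} {H : SimpleGraph V}
    (h : AvoidingColorable H S)
    (hH : ∀ u v, some u ∈ W → some v ∈ W → G.Adj u v → H.Adj u v) :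
    ColorableOn (apexGraph G S) W := by
  obtain ⟨φ, h1, h2⟩ := h
  refine ⟨fun x => x.elim 2 φ, ?_⟩
  rintro (_ | u) hu (_ | v) hv huv
  · exact absurd huv (SimpleGraph.irrefl _)
  · exact (h2 v (by simpa using huv)).symm
  · exact h2 u (by simpa using huv)
  · exact h1 u v (hH u v hu hv (by simpa using huv))

lemma AvoidingColorable.of_colorableOn [Fintype V] {S : Finset V}
    (h : ColorableOn (apexGraph G S) univ) : AvoidingColorable G S := by
  obtain ⟨φ, h⟩ := h
  refine ⟨fun v => Equiv.swap (φ none) 2 (φ (some v)), fun u v huv he => ?_, fun s hs he => ?_⟩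
  · exact h (some u) (mem_univ _) (some v) (mem_univ _) (by simpa using huv)
      ((Equiv.injective _) he)
  · rw [Equiv.swap_apply_eq_iff, Equiv.swap_apply_right] at he
    exact h (some s) (mem_univ _) none (mem_univ _) (by simpa using hs) he

lemma AvoidingColorable.of_contract {S : Finset V} {a c : V} (hac : ¬ G.Adj a c)
    (hne : a ≠ c)
    (h : AvoidingColorable (contract G a c) (S.image fun v => if v = c then a else v)) :
    AvoidingColorable G S := by
  obtain ⟨φ, h1, h2⟩ := h
  refine ⟨fun v => φ (if v = c then a else v), fun u v huv => h1 _ _ ?_, fun s hs =>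
    h2 _ (mem_image_of_mem _ hs)⟩
  have := huv.ne
  have h3 := fun x => G.adj_comm x a
  have h4 := fun x => G.adj_comm x c
  simp only [contract]
  split_ifs <;> grind

lemma cut_apexGraph_map (S A : Finset V) :
    cut (apexGraph G S) (A.map .some) (A.map .some) = cut G A A := by
  simp only [cut, sum_map, edgeInd, Function.Embedding.some_apply, apexGraph_some_some]

lemma cut_eq_card_edgeSet [Fintype V] {A : Finset V} (hA : ∀ u v, G.Adj u v → u ∈ A) :
    cut G A A = 2 * Fintype.card G.edgeSet := by
  have h := G.sum_degrees_eq_twice_card_edges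
  rw [SimpleGraph.edgeFinset_card] at h
  have h2 : cut G A A = ∑ v, (G.degree v : ℤ) := by
    unfold cut
    have h0 : ∀ u v, u ∉ A ∨ v ∉ A → edgeInd G u v = 0 := by
      rintro u v (h | h)
      · exact if_neg fun h' => h (hA u v h')
      · exact if_neg fun h' => h (hA v u h'.symm)
    rw [sum_subset (subset_univ A) fun u _ hu => sum_eq_zero fun v _ => h0 u v (Or.inl hu)]
    refine sum_congr rfl fun u _ => ?_
    rw [sum_subset (subset_univ A) fun v _ hv => h0 u v (Or.inr hv)]
    simp [edgeInd, ← SimpleGraph.card_neighborFinset_eq_degree,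
      SimpleGraph.neighborFinset_eq_filter]
  rw [h2]
  exact_mod_cast h

theorem MacLanePlanar.avoidingColorable [Fintype V] (n : ℕ) : ∀ (G : SimpleGraph V) (S : Finset V),
    MacLanePlanar G → (∀ x y z, G.Adj x y → G.Adj y z → ¬ G.Adj x z) → #S ≤ 4 →
    #{v | ∃ u, G.Adj v u} ≤ n → AvoidingColorable G S := by
  induction n using Nat.strong_induction_on with
  | _ n ih =>
  intro G S hG htf hS hn
  by_contra hcol
  obtain ⟨W, -, hW, hpot⟩ := exists_potential_le_four (apexGraph G S) univ
    (fun h => hcol (.of_colorableOn h))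
  set A : Finset V := {v | some v ∈ W} with hAdef
  have hGA : ∀ u v, G.Adj u v → u ∈ A := by
    by_contra! hx
    obtain ⟨x, y, hxy, hx⟩ := hx
    let H : SimpleGraph V :=
      { Adj := fun u v => G.Adj u v ∧ u ∈ A ∧ v ∈ A
        symm := ⟨fun u v h => ⟨h.1.symm, h.2.2, h.2.1⟩⟩
        loopless := ⟨fun u h => h.1.ne rfl⟩ }
    have hHG : H ≤ G := fun _ _ h => h.1
    have hlt : #{v | ∃ u, H.Adj v u} < n := by
      refine lt_of_lt_of_le (card_lt_card ?_) hn
      rw [Finset.ssubset_iff_of_subset (fun v hv => ?_)]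
      · exact ⟨x, by simpa using ⟨y, hxy⟩, by simp [H, hx]⟩
      · simp only [mem_filter, mem_univ, true_and] at hv ⊢
        exact hv.imp fun _ h => h.1
    have := ih _ hlt H S (hG.mono hHG)
      (fun x y z h1 h2 h3 => htf x y z h1.1 h2.1 h3.1) hS (le_of_eq (by congr!))
    exact hW (this.colorableOn fun u v hu hv h => ⟨h, by simpa [hAdef], by simpa [hAdef]⟩)
  have hcut := cut_eq_card_edgeSet hGA
  have hW4 := four_le_card_of_not_colorableOn hW
  have hsA : #(S ∩ A) ≤ #S := card_le_card inter_subset_left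
  have hsA' : #(S ∩ A) ≤ #A := card_le_card inter_subset_right
  have hpotA : (10 * #A - 3 * cut G A A ≤ 4 ∧ #W = #A) ∨
      (10 * (#A + 1) - 3 * (cut G A A + 2 * #(S ∩ A)) ≤ (4 : ℤ) ∧ #W = #A + 1) := by
    have hdis : none ∉ A.map Function.Embedding.some := by simp
    by_cases hnone : none ∈ W
    · right
      have hWA : W = insert none (A.map .some) := by
        ext (_ | x) <;> simp [hnone, hAdef]
      rw [hWA, card_insert_of_notMem hdis, card_map]
      refine ⟨?_, rfl⟩
      have hins : potential (apexGraph G S) W = potential (apexGraph G S) (A.map .some) + 10 -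
          6 * ∑ b ∈ A.map .some, edgeInd (apexGraph G S) none b := by
        rw [← potential_insert (apexGraph G S) hdis, hWA]
        congr!
      rw [hins, potential, cut_apexGraph_map, card_map] at hpot
      have : ∑ b ∈ A.map .some, edgeInd (apexGraph G S) none b = #(S ∩ A) := by
        simp only [sum_map, edgeInd, Function.Embedding.some_apply, apexGraph_none_some]
        simp [inter_comm S A, ← filter_mem_eq_inter]
      rw [this] at hpot
      linarith
    · left
      have hWA : W = A.map .some := by
        ext (_ | x) <;> simp [hnone, hAdef]
      rw [hWA, potential, cut_apexGraph_map, card_map] at hpot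
      exact ⟨hpot, by rw [hWA, card_map]⟩
  have hAne : A.Nonempty := by
    rw [← card_pos]; omega
  obtain ⟨Φ, l, hl⟩ := hG
  obtain ⟨f, a, b, c, d, hf⟩ : ∃ f a b c d, IsFourFace G l f a b c d := by
    by_contra! hno
    have := hl.euler htf hAne hGA hno
    omega
  have step : ∀ {a b c d}, IsFourFace G l f a b c d → ∃ y₁ y₂, G.Adj a y₁ ∧ G.Adj y₁ y₂ ∧
      G.Adj y₂ c := by
    intro a b c d hf
    by_contra! hp
    have hac : ¬ G.Adj a c := htf _ _ _ hf.adj_ab hf.adj_bc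
    have hlt : #{v | ∃ u, (contract G a c).Adj v u} < n := by
      refine lt_of_lt_of_le (card_lt_card ?_) hn
      rw [Finset.ssubset_iff_of_subset (fun v hv => ?_)]
      · exact ⟨c, by simpa using ⟨b, hf.adj_bc.symm⟩, by simp only [mem_filter]; simp [contract]⟩
      · simp only [mem_filter, mem_univ, true_and] at hv ⊢
        obtain ⟨u, -, -, -, h | ⟨rfl, h⟩ | ⟨rfl, h⟩⟩ := hv
        · exact ⟨u, h⟩
        · exact ⟨b, hf.adj_ab⟩
        · exact ⟨c, h.symm⟩
    exact hcol (.of_contract hac hf.ne_ac (ih _ hlt _ _ (hf.macLanePlanar_contract hl hac)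
      (not_adj_of_adj_contract htf hp) (card_image_le.trans hS) (le_of_eq (by congr!))))
  obtain ⟨y₁, y₂, h1, h2, h3⟩ := step hf
  obtain ⟨z₁, z₂, h4, h5, h6⟩ := step hf.rotate
  exact hf.not_both_paths hl htf h1 h2 h3 h4 h5 h6

end coloring

section grid

/-- Adjacency in the square grid. -/
def GridAdj (p q : ℤ × ℤ) : Prop :=
  q = (p.1 + 1, p.2) ∨ p = (q.1 + 1, q.2) ∨ q = (p.1, p.2 + 1) ∨ p = (q.1, q.2 + 1)

lemma GridAdj.symm {p q : ℤ × ℤ} (h : GridAdj p q) : GridAdj q p := by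
  unfold GridAdj at *; tauto

lemma GridAdj.ne {p q : ℤ × ℤ} (h : GridAdj p q) : p ≠ q := by
  rintro rfl
  simp [GridAdj, Prod.ext_iff] at h

/-- The cell (named by its lower left corner) on one side of a dart of the grid; the cell on the
other side is that of the reversed dart. -/
def gridCell (p q : ℤ × ℤ) : ℤ × ℤ :=
  if q = (p.1 + 1, p.2) ∨ q = (p.1, p.2 + 1) then p
  else if p = (q.1 + 1, q.2) then (q.1, q.2 - 1) else (q.1 - 1, q.2)

@[simp] lemma gridCell_right (i j : ℤ) : gridCell (i, j) (i + 1, j) = (i, j) := by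
  simp [gridCell]

@[simp] lemma gridCell_left (i j : ℤ) : gridCell (i + 1, j) (i, j) = (i, j - 1) := by
  simp [gridCell]; omega

@[simp] lemma gridCell_up (i j : ℤ) : gridCell (i, j) (i, j + 1) = (i, j) := by
  simp [gridCell]

@[simp] lemma gridCell_down (i j : ℤ) : gridCell (i, j + 1) (i, j) = (i - 1, j) := by
  simp [gridCell]; omega

lemma sum_eq_of_gridAdj {D : ℤ × ℤ → ℤ × ℤ → ZMod 2} {U : Finset (ℤ × ℤ)}
    (hU : ∀ p q, D p q ≠ 0 → GridAdj p q ∧ q ∈ U) (i j : ℤ) :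
    ∑ q ∈ U, D (i, j) q = D (i, j) (i + 1, j) + D (i, j) (i - 1, j) + D (i, j) (i, j + 1) +
      D (i, j) (i, j - 1) := by
  set N : Finset (ℤ × ℤ) := {(i + 1, j), (i - 1, j), (i, j + 1), (i, j - 1)} with hN
  have h1 : ∑ q ∈ U, D (i, j) q = ∑ q ∈ U ∪ N, D (i, j) q := by
    refine sum_subset subset_union_left fun q _ hq => ?_
    by_contra h
    exact hq (hU _ _ h).2
  have h2 : ∑ q ∈ N, D (i, j) q = ∑ q ∈ U ∪ N, D (i, j) q := by
    refine sum_subset subset_union_right fun q _ hq => ?_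
    by_contra h
    obtain ⟨x, y⟩ := q
    have := (hU _ _ h).1
    simp only [GridAdj, Prod.ext_iff] at this
    simp only [hN, mem_insert, mem_singleton, Prod.ext_iff] at hq
    omega
  rw [h1, ← h2, hN, sum_insert, sum_insert, sum_insert, sum_singleton]
  · ring
  all_goals
    simp only [mem_insert, mem_singleton, Prod.ext_iff]
    omega

/-- A finitely supported even chain of the grid is a boundary. -/
lemma exists_gridCell_eq {z : ℤ × ℤ → ℤ × ℤ → ZMod 2} {U : Finset (ℤ × ℤ)}
    (hs : ∀ p q, z p q = z q p) (hU : ∀ p q, z p q ≠ 0 → GridAdj p q ∧ q ∈ U)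
    (hsum : ∀ p, ∑ q ∈ U, z p q = 0) :
    ∃ W : ℤ × ℤ → ZMod 2, ∀ p q, GridAdj p q → z p q = W (gridCell p q) + W (gridCell q p) := by
  obtain ⟨N, hN⟩ : ∃ N : ℤ, ∀ p ∈ U, N < p.1 := by
    obtain ⟨N, hN⟩ := (U.image Prod.fst).bddBelow
    exact ⟨N - 1, fun p hp => by
      have := hN (mem_coe.2 (mem_image_of_mem Prod.fst hp)); omega⟩
  have hz : ∀ p q, p.1 ≤ N → z p q = 0 := by
    intro p q hp
    by_contra h
    rw [hs] at h
    have := hN _ (hU _ _ h).2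
    omega
  set W : ℤ × ℤ → ZMod 2 := fun p => ∑ k ∈ Icc N p.1, z (k, p.2) (k, p.2 + 1) with hW
  have hWlow : ∀ i j, i ≤ N → W (i, j) = 0 := by
    intro i j hi
    refine sum_eq_zero fun k hk => hz _ _ ?_
    exact (mem_Icc.1 hk).2.trans hi
  have hWstep : ∀ i j, W (i, j) = W (i - 1, j) + z (i, j) (i, j + 1) := by
    intro i j
    by_cases hi : i ≤ N
    · rw [hWlow _ _ hi, hWlow _ _ (by omega), hz _ _ hi, add_zero]
    · have : Icc N i = insert i (Icc N (i - 1)) := by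
        ext x; simp only [mem_Icc, mem_insert]; omega
      simp only [hW, this]
      rw [sum_insert (by simp), add_comm]
  have h4 : ∀ i j, z (i, j) (i + 1, j) + z (i - 1, j) (i, j) + z (i, j) (i, j + 1) +
      z (i, j - 1) (i, j) = 0 := by
    intro i j
    rw [← hsum (i, j), sum_eq_of_gridAdj hU, hs (i - 1, j), hs (i, j - 1)]
  have hh : ∀ i j, W (i, j) + W (i, j - 1) = z (i, j) (i + 1, j) := by
    intro i j
    by_cases hi : i ≤ N
    · rw [hWlow _ _ hi, hWlow _ _ hi, hz _ _ hi, add_zero]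
    · have hi' : N ≤ i := by omega
      induction i, hi' using Int.leInduction with
      | base => exact absurd le_rfl hi
      | succ n hn ih =>
        have ih' : W (n, j) + W (n, j - 1) = z (n, j) (n + 1, j) := by
          by_cases hn' : n ≤ N
          · rw [hWlow _ _ hn', hWlow _ _ hn', hz _ _ hn', add_zero]
          · exact ih hn'
        have e1 := hWstep (n + 1) j
        have e2 := hWstep (n + 1) (j - 1)
        have e3 := h4 (n + 1) j
        simp only [add_sub_cancel_right, sub_add_cancel] at e1 e2 e3
        rw [e1, e2]
        rw [← ih'] at e3
        revert e3
        generalize W (n, j) = x1, W (n, j - 1) = x2, z (n + 1, j) (n + 1, j + 1) = x3,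
          z (n + 1, j - 1) (n + 1, j) = x4, z (n + 1, j) (n + 1 + 1, j) = x5
        revert x1 x2 x3 x4 x5
        decide
  have hv : ∀ i j, W (i, j) + W (i - 1, j) = z (i, j) (i, j + 1) := by
    intro i j
    rw [hWstep]
    generalize W (i - 1, j) = x, z (i, j) (i, j + 1) = y
    revert x y; decide
  refine ⟨W, ?_⟩
  rintro ⟨i, j⟩ ⟨i', j'⟩ (h | h | h | h) <;> simp only [Prod.mk.injEq] at h <;>
    obtain ⟨rfl, rfl⟩ := h
  · rw [gridCell_right, gridCell_left, hh]
  · rw [gridCell_right, gridCell_left, hs, ← hh, add_comm (W _)]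
  · rw [gridCell_up, gridCell_down, hv]
  · rw [gridCell_up, gridCell_down, hs, ← hv, add_comm (W _)]

/-- A chain of edges inside a connected set of grid points with prescribed end points. -/
lemma exists_chain_of_reflTransGen {B : Finset (ℤ × ℤ)} {p q : ℤ × ℤ} (hp : p ∈ B)
    (h : Relation.ReflTransGen (fun x y => GridAdj x y ∧ y ∈ B) p q) :
    q ∈ B ∧ ∃ I : ℤ × ℤ → ℤ × ℤ → ZMod 2, (∀ x y, I x y = I y x) ∧
      (∀ x y, I x y ≠ 0 → GridAdj x y ∧ x ∈ B ∧ y ∈ B) ∧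
      ∀ x, ∑ y ∈ B, I x y = (if x = p then 1 else 0) + if x = q then 1 else 0 := by
  induction h with
  | refl =>
    exact ⟨hp, fun _ _ => 0, fun _ _ => rfl, fun _ _ h => absurd rfl h, fun x => by
      rw [CharTwo.add_self_eq_zero, sum_const_zero]⟩
  | @tail b c _ hbc ih =>
    obtain ⟨hb, I, h1, h2, h3⟩ := ih
    refine ⟨hbc.2, fun x y => I x y + edgeChain b c x y, fun x y => ?_, fun x y hxy => ?_,
      fun x => ?_⟩
    · simp only [h1 x y, edgeChain_symm _ _ x y]
    · by_cases hI : I x y = 0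
      · have : s(x, y) = s(b, c) := by
          by_contra hn
          simp [edgeChain, hn, hI] at hxy
        rcases Sym2.eq_iff.1 this with ⟨rfl, rfl⟩ | ⟨rfl, rfl⟩
        · exact ⟨hbc.1, hb, hbc.2⟩
        · exact ⟨hbc.1.symm, hbc.2, hb⟩
      · exact h2 x y hI
    · rw [sum_add_distrib, h3, sum_edgeChain_of_mem hbc.1.ne hb hbc.2]
      have key : ∀ x₁ x₂ x₃ : ZMod 2, x₁ + x₂ + (x₂ + x₃) = x₁ + x₃ := by decide
      convert key _ _ _

/-- In a connected set of grid points every even set is the boundary of a chain of edges. -/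
lemma exists_chain_of_sum_eq_zero {B : Finset (ℤ × ℤ)}
    (hB : ∀ p ∈ B, ∀ q ∈ B, Relation.ReflTransGen (fun x y => GridAdj x y ∧ y ∈ B) p q)
    {t : ℤ × ℤ → ZMod 2} (ht : ∑ p ∈ B, t p = 0) :
    ∃ I : ℤ × ℤ → ℤ × ℤ → ZMod 2, (∀ x y, I x y = I y x) ∧
      (∀ x y, I x y ≠ 0 → GridAdj x y ∧ x ∈ B ∧ y ∈ B) ∧ ∀ x ∈ B, ∑ y ∈ B, I x y = t x := by
  obtain rfl | ⟨p₀, hp₀⟩ := B.eq_empty_or_nonempty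
  · exact ⟨fun _ _ => 0, by simp⟩
  choose! I h1 h2 h3 using fun p (hp : p ∈ B) =>
    (exists_chain_of_reflTransGen hp (hB p hp p₀ hp₀)).2
  refine ⟨fun x y => ∑ p ∈ B, t p * I p x y, fun x y => ?_, fun x y hxy => ?_, fun x hx => ?_⟩
  · exact sum_congr rfl fun p hp => by rw [h1 p hp]
  · obtain ⟨p, hp, hne⟩ := exists_ne_zero_of_sum_ne_zero hxy
    exact h2 p hp x y (right_ne_zero_of_mul hne)
  · rw [sum_comm]
    simp only [← mul_sum]
    rw [sum_congr rfl fun p hp => by rw [h3 p hp x]]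
    simp only [mul_add, sum_add_distrib, ← sum_mul, ht, zero_mul, add_zero]
    simp [hx]

end grid

section gridMinor

variable {V : Type u}

/-- `B` models `G` as a minor of the square grid. -/
structure IsGridModel (G : SimpleGraph V) (B : V → Finset (ℤ × ℤ)) : Prop where
  eq_of_mem : ∀ p u v, p ∈ B u → p ∈ B v → u = v
  connected : ∀ u, ∀ p ∈ B u, ∀ q ∈ B u,
    Relation.ReflTransGen (fun x y => GridAdj x y ∧ y ∈ B u) p q
  exists_adj : ∀ u v, G.Adj u v → ∃ p ∈ B u, ∃ q ∈ B v, GridAdj p q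

/-- The grid edges used by a grid model with connecting edges `P u v`, `P v u`. -/
def IsModelEdge (G : SimpleGraph V) (B : V → Finset (ℤ × ℤ)) (P : V → V → ℤ × ℤ)
    (p q : ℤ × ℤ) : Prop :=
  (∃ u, p ∈ B u ∧ q ∈ B u) ∨ ∃ u v, G.Adj u v ∧ p = P u v ∧ q = P v u

namespace IsGridModel

variable {G : SimpleGraph V} {B : V → Finset (ℤ × ℤ)}

lemma exists_connecting (h : IsGridModel G B) :
    ∃ P : V → V → ℤ × ℤ, ∀ u v, G.Adj u v → P u v ∈ B u ∧ GridAdj (P u v) (P v u) := by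
  choose! f hf g hg hfg using h.exists_adj
  refine ⟨fun u v => if WellOrderingRel u v then f u v else g v u, fun u v huv => ?_⟩
  by_cases h1 : WellOrderingRel u v
  · have h2 : ¬ WellOrderingRel v u := fun h2 => asymm_of WellOrderingRel h1 h2
    simp only [h1, h2, if_true, if_false]
    exact ⟨hf u v huv, hfg u v huv⟩
  · have h2 : WellOrderingRel v u := by
      rcases trichotomous_of WellOrderingRel u v with h | h | h
      · exact absurd h h1
      · exact absurd h huv.ne
      · exact h
    simp only [h1, h2, if_true, if_false]
    exact ⟨hg v u huv.symm, (hfg v u huv.symm).symm⟩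

variable {P : V → V → ℤ × ℤ}

lemma eq_of_isModelEdge (h : IsGridModel G B) (hP : ∀ u v, G.Adj u v → P u v ∈ B u) {p q : ℤ × ℤ}
    {u v : V} (huv : u ≠ v) (hp : p ∈ B u) (hq : q ∈ B v) (hpq : IsModelEdge G B P p q) :
    G.Adj u v ∧ p = P u v ∧ q = P v u := by
  rcases hpq with ⟨x, hx, hy⟩ | ⟨x, y, hxy, rfl, rfl⟩
  · exact absurd ((h.eq_of_mem p u x hp hx).trans (h.eq_of_mem q x v hy hq)) huv
  · obtain rfl := h.eq_of_mem _ _ _ hp (hP _ _ hxy)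
    obtain rfl := h.eq_of_mem _ _ _ hq (hP _ _ hxy.symm)
    exact ⟨hxy, rfl, rfl⟩

lemma sum_sum_eq (h : IsGridModel G B) (hP : ∀ u v, G.Adj u v → P u v ∈ B u)
    {D : ℤ × ℤ → ℤ × ℤ → ZMod 2} (hD : ∀ p q, D p q ≠ 0 → IsModelEdge G B P p q) {u v : V}
    (huv : u ≠ v) :
    ∑ p ∈ B u, ∑ q ∈ B v, D p q = if G.Adj u v then D (P u v) (P v u) else 0 := by
  split_ifs with hadj
  · rw [sum_eq_single_of_mem _ (hP _ _ hadj), sum_eq_single_of_mem _ (hP _ _ hadj.symm)]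
    · intro q hq hne
      by_contra h0
      exact hne (h.eq_of_isModelEdge hP huv (hP _ _ hadj) hq (hD _ _ h0)).2.2
    · intro p hp hne
      refine sum_eq_zero fun q hq => ?_
      by_contra h0
      exact hne (h.eq_of_isModelEdge hP huv hp hq (hD _ _ h0)).2.1
  · refine sum_eq_zero fun p hp => sum_eq_zero fun q hq => ?_
    by_contra h0
    exact hadj (h.eq_of_isModelEdge hP huv hp hq (hD _ _ h0)).1

lemma mem_of_isModelEdge [Fintype V] (hP : ∀ u v, G.Adj u v → P u v ∈ B u) {p q : ℤ × ℤ}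
    (hpq : IsModelEdge G B P p q) : q ∈ univ.biUnion B := by
  rw [mem_biUnion]
  rcases hpq with ⟨u, _, hu⟩ | ⟨u, v, huv, _, rfl⟩
  · exact ⟨u, mem_univ _, hu⟩
  · exact ⟨v, mem_univ _, hP _ _ huv.symm⟩

lemma sum_biUnion [Fintype V] (h : IsGridModel G B) (f : ℤ × ℤ → ZMod 2) :
    ∑ q ∈ univ.biUnion B, f q = ∑ v, ∑ q ∈ B v, f q := by
  refine Finset.sum_biUnion fun u _ v _ huv => disjoint_left.2 fun p hp hq => ?_
  exact huv (h.eq_of_mem p u v hp hq)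

/-- Merge the grid cells on both sides of the grid edges which are not used by the model. -/
def face (G : SimpleGraph V) (B : V → Finset (ℤ × ℤ)) (P : V → V → ℤ × ℤ) (u v : V) :
    Quot fun x y => ∃ p q, GridAdj p q ∧ ¬ IsModelEdge G B P p q ∧
      x = gridCell p q ∧ y = gridCell q p :=
  Quot.mk _ (gridCell (P u v) (P v u))

lemma isModelEdge_symm {p q : ℤ × ℤ} (h : IsModelEdge G B P p q) : IsModelEdge G B P q p := by
  rcases h with ⟨u, h1, h2⟩ | ⟨u, v, h, h1, h2⟩
  · exact Or.inl ⟨u, h2, h1⟩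
  · exact Or.inr ⟨v, u, h.symm, h2, h1⟩

lemma sum_faceBoundary [Fintype V] (h : IsGridModel G B)
    (hP : ∀ u v, G.Adj u v → P u v ∈ B u ∧ GridAdj (P u v) (P v u)) (w) (u : V) :
    ∑ v, faceBoundary G (face G B P) w u v = 0 := by
  set D : ℤ × ℤ → ℤ × ℤ → ZMod 2 := fun p q =>
    if GridAdj p q then w (Quot.mk _ (gridCell p q)) + w (Quot.mk _ (gridCell q p)) else 0 with hDd
  have hadj : ∀ p q, D p q ≠ 0 → GridAdj p q := by
    intro p q h0
    by_contra hn
    exact h0 (if_neg hn)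
  have hD : ∀ p q, D p q ≠ 0 → IsModelEdge G B P p q := by
    intro p q h0
    by_contra hn
    apply h0
    simp only [hDd]
    rw [if_pos (hadj p q h0), Quot.sound ⟨p, q, hadj p q h0, hn, rfl, rfl⟩,
      CharTwo.add_self_eq_zero]
  have hrow : ∀ p, ∑ q ∈ univ.biUnion B, D p q = 0 := by
    rintro ⟨i, j⟩
    rw [sum_eq_of_gridAdj fun p q h0 => ⟨hadj p q h0, mem_of_isModelEdge (fun u v h => (hP u v h).1)
      (hD p q h0)⟩]
    have e1 := gridCell_left (i - 1) j
    have e2 := gridCell_right (i - 1) j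
    have e3 := gridCell_down i (j - 1)
    have e4 := gridCell_up i (j - 1)
    simp only [sub_add_cancel] at e1 e2 e3 e4
    simp only [hDd, gridCell_right, gridCell_left, gridCell_up, gridCell_down, e1, e2, e3, e4]
    rw [if_pos (by simp [GridAdj]), if_pos (by simp [GridAdj]), if_pos (by simp [GridAdj]),
      if_pos (by simp [GridAdj])]
    have key : ∀ a b c d : ZMod 2, a + b + (c + d) + (a + d) + (c + b) = 0 := by decide
    exact key _ _ _ _
  have hsymm : ∀ p q, D p q = D q p := by
    intro p q
    by_cases hpq : GridAdj p q
    · simp only [hDd]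
      rw [if_pos hpq, if_pos hpq.symm, add_comm]
    · simp only [hDd]
      rw [if_neg hpq, if_neg fun h => hpq h.symm]
  have hdiag : ∀ p, D p p = 0 := by
    intro p
    by_contra h0
    exact (hadj p p h0).ne rfl
  have : ∀ v, faceBoundary G (face G B P) w u v = ∑ p ∈ B u, ∑ q ∈ B v, D p q := by
    intro v
    by_cases huv : u = v
    · subst huv
      rw [sum_sum_eq_zero hsymm hdiag, faceBoundary_of_not_adj _ _ (G.irrefl)]
    · rw [h.sum_sum_eq (fun u v h => (hP u v h).1) hD huv]
      split_ifs with hG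
      · rw [faceBoundary_of_adj _ _ hG]
        simp only [hDd]
        rw [if_pos (hP _ _ hG).2]
        rfl
      · exact faceBoundary_of_not_adj _ _ hG
  simp only [this]
  rw [sum_comm]
  refine sum_eq_zero fun p _ => ?_
  rw [← h.sum_biUnion, hrow]

lemma exists_eq [Fintype V] (h : IsGridModel G B)
    (hP : ∀ u v, G.Adj u v → P u v ∈ B u ∧ GridAdj (P u v) (P v u)) {z : V → V → ZMod 2}
    (hz : IsEvenChain G z) : ∃ w, z = faceBoundary G (face G B P) w := by
  have hP' : ∀ u v, G.Adj u v → P u v ∈ B u := fun u v h => (hP u v h).1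
  set C : ℤ × ℤ → ℤ × ℤ → ZMod 2 := fun p q =>
    ∑ u, ∑ v, if p = P u v ∧ q = P v u then z u v else 0 with hC
  have hCne : ∀ p q, C p q ≠ 0 → ∃ u v, G.Adj u v ∧ p = P u v ∧ q = P v u := by
    intro p q h0
    obtain ⟨u, _, hu⟩ := exists_ne_zero_of_sum_ne_zero h0
    obtain ⟨v, _, hv⟩ := exists_ne_zero_of_sum_ne_zero hu
    by_cases hc : p = P u v ∧ q = P v u
    · rw [if_pos hc] at hv
      exact ⟨u, v, by_contra fun hn => hv (hz.eq_zero u v hn), hc⟩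
    · exact absurd (if_neg hc) hv
  have hCsymm : ∀ p q, C p q = C q p := by
    intro p q
    simp only [hC]
    rw [sum_comm]
    refine sum_congr rfl fun u _ => sum_congr rfl fun v _ => ?_
    simp only [hz.symm u v, and_comm]
  have hCP : ∀ u v, G.Adj u v → C (P u v) (P v u) = z u v := by
    intro u v huv
    simp only [hC]
    have hne : ∀ x y, z x y ≠ 0 → P u v = P x y ∧ P v u = P y x → u = x ∧ v = y := by
      intro x y h0 he
      have hxy : G.Adj x y := by_contra fun hn => h0 (hz.eq_zero x y hn)
      exact ⟨h.eq_of_mem (P u v) _ _ (hP' _ _ huv) (he.1 ▸ hP' _ _ hxy),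
        h.eq_of_mem (P v u) _ _ (hP' _ _ huv.symm) (he.2 ▸ hP' _ _ hxy.symm)⟩
    rw [sum_eq_single_of_mem u (mem_univ _), sum_eq_single_of_mem v (mem_univ _)]
    · simp
    · intro y _ hy
      by_contra h0
      rw [ite_eq_right_iff, Classical.not_imp] at h0
      exact hy (hne _ _ h0.2 h0.1).2.symm
    · intro x _ hx
      refine sum_eq_zero fun y _ => ?_
      by_contra h0
      rw [ite_eq_right_iff, Classical.not_imp] at h0
      exact hx (hne _ _ h0.2 h0.1).1.symm
  have hCedge : ∀ p q, C p q ≠ 0 → IsModelEdge G B P p q := fun p q h0 => Or.inr (hCne p q h0)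
  have ht : ∀ u, ∑ p ∈ B u, ∑ q ∈ univ.biUnion B, C p q = 0 := by
    intro u
    simp only [h.sum_biUnion]
    rw [sum_comm, ← hz.sum_eq_zero u]
    refine sum_congr rfl fun v _ => ?_
    by_cases huv : u = v
    · subst huv
      rw [hz.eq_zero _ _ G.irrefl]
      refine sum_eq_zero fun p hp => sum_eq_zero fun q hq => ?_
      by_contra h0
      obtain ⟨x, y, hxy, rfl, rfl⟩ := hCne p q h0
      exact hxy.ne ((h.eq_of_mem _ _ _ (hP' _ _ hxy) hp).trans
        (h.eq_of_mem _ _ _ hq (hP' _ _ hxy.symm)))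
    · rw [h.sum_sum_eq hP' hCedge huv]
      split_ifs with hG
      · exact hCP u v hG
      · exact (hz.eq_zero u v hG).symm
  choose I hI1 hI2 hI3 using fun u => exists_chain_of_sum_eq_zero (h.connected u) (ht u)
  have hIedge : ∀ p q, ∑ u, I u p q ≠ 0 → ∃ u, GridAdj p q ∧ p ∈ B u ∧ q ∈ B u := by
    intro p q h0
    obtain ⟨u, _, hu⟩ := exists_ne_zero_of_sum_ne_zero h0
    exact ⟨u, hI2 u p q hu⟩
  have hedge : ∀ p q, C p q + ∑ u, I u p q ≠ 0 → GridAdj p q ∧ IsModelEdge G B P p q := by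
    intro p q h0
    by_cases h1 : C p q = 0
    · rw [h1, zero_add] at h0
      obtain ⟨u, hu⟩ := hIedge p q h0
      exact ⟨hu.1, Or.inl ⟨u, hu.2⟩⟩
    · obtain ⟨u, v, huv, rfl, rfl⟩ := hCne p q h1
      exact ⟨(hP u v huv).2, Or.inr ⟨u, v, huv, rfl, rfl⟩⟩
  obtain ⟨W, hW⟩ := exists_gridCell_eq (z := fun p q => C p q + ∑ u, I u p q)
    (U := univ.biUnion B) (fun p q => by simp only [hCsymm p q, hI1 _ p q])
    (fun p q h0 => ⟨(hedge p q h0).1, mem_of_isModelEdge hP' (hedge p q h0).2⟩) (by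
      intro p
      by_cases hp : p ∈ univ.biUnion B
      · obtain ⟨u, _, hu⟩ := mem_biUnion.1 hp
        have h1 : ∑ q ∈ univ.biUnion B, ∑ u, I u p q = ∑ q ∈ B u, I u p q := by
          rw [sum_comm, sum_eq_single_of_mem u (mem_univ _)]
          · refine (sum_subset (subset_biUnion_of_mem B (mem_univ u)) fun q _ hq => ?_).symm
            by_contra h0
            exact hq (hI2 _ _ _ h0).2.2
          · intro v _ hv
            refine sum_eq_zero fun q _ => ?_
            by_contra h0
            exact hv (h.eq_of_mem p _ _ (hI2 _ _ _ h0).2.1 hu)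
        rw [sum_add_distrib, h1, hI3 u p hu, CharTwo.add_self_eq_zero]
      · refine sum_eq_zero fun q _ => ?_
        by_contra h0
        exact hp (mem_of_isModelEdge hP' (isModelEdge_symm (hedge p q h0).2)))
  refine ⟨Quot.lift W ?_, ?_⟩
  · rintro _ _ ⟨p, q, hpq, hn, rfl, rfl⟩
    rw [← CharTwo.add_eq_zero, ← hW p q hpq]
    by_contra h0
    exact hn (hedge p q h0).2
  · ext1 u; ext1 v
    by_cases huv : G.Adj u v
    · rw [faceBoundary_of_adj _ _ huv]
      refine Eq.trans ?_ (hW _ _ (hP u v huv).2)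
      rw [hCP u v huv]
      have : ∑ x, I x (P u v) (P v u) = 0 := by
        by_contra h0
        obtain ⟨x, _, h1, h2⟩ := hIedge _ _ h0
        exact huv.ne ((h.eq_of_mem _ _ _ (hP' _ _ huv) h1).trans
          (h.eq_of_mem _ _ _ h2 (hP' _ _ huv.symm)))
      rw [this, add_zero]
    · rw [faceBoundary_of_not_adj _ _ huv, hz.eq_zero u v huv]

lemma macLanePlanar [Fintype V] (h : IsGridModel G B) : MacLanePlanar G := by
  obtain ⟨P, hP⟩ := h.exists_connecting
  exact ⟨_, face G B P, h.sum_faceBoundary hP, fun _ hz => h.exists_eq hP hz⟩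

end IsGridModel

end gridMinor

section stars

variable {V : Type u}

lemma reflTransGen_symm {B : Set (ℤ × ℤ)} {p q : ℤ × ℤ} (hp : p ∈ B)
    (h : Relation.ReflTransGen (fun x y => GridAdj x y ∧ y ∈ B) p q) :
    Relation.ReflTransGen (fun x y => GridAdj x y ∧ y ∈ B) q p := by
  induction h with
  | refl => exact .refl
  | @tail b c hb hbc ih =>
    refine .head ⟨hbc.1.symm, ?_⟩ ih
    rcases hb.cases_tail with rfl | ⟨a, _, hab⟩
    exacts [hp, hab.2]

/-- A grid model from a family of connected stars `K u` and, for each edge `r u v`, a connected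
middle piece `M u v` meeting both stars. -/
lemma exists_isGridModel [Fintype V] {G : SimpleGraph V} {r : V → V → Prop}
    (hr : ∀ u v, G.Adj u v → r u v ∨ r v u) (hne : ∀ u v, r u v → u ≠ v)
    (K : V → Finset (ℤ × ℤ)) (M : V → V → Finset (ℤ × ℤ))
    (hK : ∀ u, ∀ p ∈ K u, ∀ q ∈ K u,
      Relation.ReflTransGen (fun x y => GridAdj x y ∧ y ∈ K u) p q)
    (hM : ∀ u v, r u v → ∀ p ∈ M u v, ∀ q ∈ M u v,
      Relation.ReflTransGen (fun x y => GridAdj x y ∧ y ∈ M u v) p q)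
    (hKK : ∀ p u v, p ∈ K u → p ∈ K v → u = v)
    (hMK : ∀ p u v w, r u v → p ∈ M u v → p ∈ K w → w = u ∨ w = v)
    (hMM : ∀ p u v u' v', r u v → r u' v' → p ∈ M u v → p ∈ M u' v' → u = u')
    (hstart : ∀ u v, r u v → ∃ p ∈ M u v, p ∈ K u)
    (hend : ∀ u v, r u v → ∃ p ∈ M u v, p ∈ K v) :
    ∃ B, IsGridModel G B := by
  set C : V → V → Finset (ℤ × ℤ) := fun u v => {p ∈ M u v | p ∉ K v ∧ ∃ q ∈ M u v, q ∈ K u ∧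
    Relation.ReflTransGen (fun x y => GridAdj x y ∧ y ∈ M u v ∧ y ∉ K v) q p} with hC
  set B : V → Finset (ℤ × ℤ) := fun u => K u ∪ ({v | r u v} : Finset V).biUnion (C u) with hB
  have memB : ∀ u p, p ∈ B u ↔ p ∈ K u ∨ ∃ v, r u v ∧ p ∈ C u v := by
    intro u p
    simp only [hB, mem_union, mem_biUnion, mem_filter, mem_univ, true_and]
  have hadj : ∀ u v, r u v → ∃ p ∈ B u, ∃ q ∈ B v, GridAdj p q := by
    intro u v huv
    obtain ⟨p, hpM, hpK⟩ := hstart u v huv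
    obtain ⟨q, hqM, hqK⟩ := hend u v huv
    have hpC : p ∈ C u v := mem_filter.2 ⟨hpM, fun h => hne u v huv (hKK p u v hpK h),
      p, hpM, hpK, .refl⟩
    have key : ∀ x, Relation.ReflTransGen (fun x y => GridAdj x y ∧ y ∈ M u v) p x →
        x ∈ C u v ∨ ∃ a ∈ C u v, ∃ b ∈ K v, GridAdj a b := by
      intro x hx
      induction hx with
      | refl => exact Or.inl hpC
      | @tail b c _ hbc ih =>
        rcases ih with ih | ih
        · by_cases hc : c ∈ K v
          · exact Or.inr ⟨b, ih, c, hc, hbc.1⟩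
          · obtain ⟨_, _, q, hq, hqK, hqb⟩ := mem_filter.1 ih
            exact Or.inl (mem_filter.2 ⟨hbc.2, hc, q, hq, hqK, hqb.tail ⟨hbc.1, hbc.2, hc⟩⟩)
        · exact Or.inr ih
    rcases key q (hM u v huv p hpM q hqM) with h | ⟨a, ha, b, hb, hab⟩
    · exact absurd hqK (mem_filter.1 h).2.1
    · exact ⟨a, (memB u a).2 (Or.inr ⟨v, huv, ha⟩), b, (memB v b).2 (Or.inl hb), hab⟩
  refine ⟨B, fun p u w hu hw => ?_, fun u => ?_, fun u v huv => ?_⟩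
  · rw [memB] at hu hw
    have aux : ∀ u v w, r u v → p ∈ C u v → p ∈ K w → u = w := by
      intro u v w huv hp hw
      obtain ⟨h1, h2, _⟩ := mem_filter.1 hp
      rcases hMK p u v w huv h1 hw with rfl | rfl
      · rfl
      · exact absurd hw h2
    rcases hu with hu | ⟨v, huv, hu⟩ <;> rcases hw with hw | ⟨x, hwx, hw⟩
    · exact hKK p u w hu hw
    · exact (aux w x u hwx hw hu).symm
    · exact aux u v w huv hu hw
    · exact hMM p u v w x huv hwx (mem_filter.1 hu).1 (mem_filter.1 hw).1
  · have hreach : ∀ p ∈ B u, ∃ q ∈ K u,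
        Relation.ReflTransGen (fun x y => GridAdj x y ∧ y ∈ B u) q p := by
      intro p hp
      rw [memB] at hp
      rcases hp with hp | ⟨v, huv, hp⟩
      · exact ⟨p, hp, .refl⟩
      · obtain ⟨-, -, q, hqM, hqK, hq⟩ := mem_filter.1 hp
        refine ⟨q, hqK, ?_⟩
        clear hp
        induction hq with
        | refl => exact .refl
        | @tail b c hb hbc ih =>
          refine ih.tail ⟨hbc.1, (memB u c).2 (Or.inr ⟨v, huv, ?_⟩)⟩
          exact mem_filter.2 ⟨hbc.2.1, hbc.2.2, q, hqM, hqK, hb.tail hbc⟩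
    intro p hp q hq
    obtain ⟨p', hp', h1⟩ := hreach p hp
    obtain ⟨q', hq', h2⟩ := hreach q hq
    have h3 : Relation.ReflTransGen (fun x y => GridAdj x y ∧ y ∈ B u) p' q' :=
      Relation.ReflTransGen.mono (fun x y h => ⟨h.1, (memB u y).2 (Or.inl h.2)⟩)
        p' q' (hK u p' hp' q' hq')
    exact (reflTransGen_symm (B := B u) ((memB u p').2 (Or.inl hp')) h1).trans (h3.trans h2)
  · rcases hr u v huv with h | h
    · exact hadj u v h
    · obtain ⟨p, hp, q, hq, hpq⟩ := hadj v u h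
      exact ⟨q, hq, p, hp, hpq.symm⟩

end stars

section gridNear

/-- The grid points close to a subset of the plane. -/
def gridNear (K : Set (ℝ × ℝ)) : Set (ℤ × ℤ) :=
  {p | ∃ x ∈ K, |(p.1 : ℝ) - x.1| ≤ 1 ∧ |(p.2 : ℝ) - x.2| ≤ 1}

lemma gridNear_finite {K : Set (ℝ × ℝ)} (hK : Bornology.IsBounded K) : (gridNear K).Finite := by
  obtain ⟨R, hR⟩ := hK.exists_norm_le
  refine (Set.finite_Icc ((-(⌈R⌉ + 1), -(⌈R⌉ + 1)) : ℤ × ℤ) (⌈R⌉ + 1, ⌈R⌉ + 1)).subset ?_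
  rintro ⟨i, j⟩ ⟨x, hx, h1, h2⟩
  have h3 : |x.1| ≤ R := (norm_fst_le x).trans (hR x hx)
  have h4 : |x.2| ≤ R := (norm_snd_le x).trans (hR x hx)
  have h5 := Int.le_ceil R
  rw [abs_le] at h1 h2 h3 h4
  dsimp only at h1 h2
  have a1 : (i : ℝ) ≤ ((⌈R⌉ + 1 : ℤ) : ℝ) := by push_cast; linarith
  have a2 : ((-(⌈R⌉ + 1) : ℤ) : ℝ) ≤ i := by push_cast; linarith
  have a3 : (j : ℝ) ≤ ((⌈R⌉ + 1 : ℤ) : ℝ) := by push_cast; linarith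
  have a4 : ((-(⌈R⌉ + 1) : ℤ) : ℝ) ≤ j := by push_cast; linarith
  exact ⟨⟨Int.cast_le.1 a2, Int.cast_le.1 a4⟩, ⟨Int.cast_le.1 a1, Int.cast_le.1 a3⟩⟩

lemma reflTransGen_of_Icc {B : Set (ℤ × ℤ)} (f : ℤ → ℤ × ℤ) (hf : ∀ i, GridAdj (f i) (f (i + 1)))
    {a b : ℤ} (h : ∀ i, min a b ≤ i → i ≤ max a b → f i ∈ B) :
    Relation.ReflTransGen (fun x y => GridAdj x y ∧ y ∈ B) (f a) (f b) := by
  wlog hab : a ≤ b generalizing a b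
  · refine reflTransGen_symm (h b (min_le_right _ _) (le_max_right _ _)) (this ?_ (by omega))
    rwa [min_comm, max_comm]
  rw [min_eq_left hab, max_eq_right hab] at h
  induction b, hab using Int.leInduction with
  | base => exact .refl
  | succ n hn ih =>
    exact (ih fun i h1 h2 => h i h1 (by omega)).tail ⟨hf n, h _ (by omega) le_rfl⟩

lemma reflTransGen_of_near {K : Set (ℝ × ℝ)} {x : ℝ × ℝ} (hx : x ∈ K) {p q : ℤ × ℤ}
    (hp : |(p.1 : ℝ) - x.1| ≤ 1 ∧ |(p.2 : ℝ) - x.2| ≤ 1)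
    (hq : |(q.1 : ℝ) - x.1| ≤ 1 ∧ |(q.2 : ℝ) - x.2| ≤ 1) :
    Relation.ReflTransGen (fun x y => GridAdj x y ∧ y ∈ gridNear K) p q := by
  have between : ∀ (a b i : ℤ) (t : ℝ), |(a : ℝ) - t| ≤ 1 → |(b : ℝ) - t| ≤ 1 → min a b ≤ i →
      i ≤ max a b → |(i : ℝ) - t| ≤ 1 := by
    intro a b i t ha hb h1 h2
    rw [abs_le] at ha hb ⊢
    rcases min_le_iff.1 h1 with h1 | h1 <;> rcases le_max_iff.1 h2 with h2 | h2 <;>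
    · have h1' : ((_ : ℤ) : ℝ) ≤ _ := Int.cast_le.2 h1
      have h2' : ((_ : ℤ) : ℝ) ≤ _ := Int.cast_le.2 h2
      constructor <;> linarith
  refine Relation.ReflTransGen.trans (b := (q.1, p.2)) ?_ ?_
  · exact reflTransGen_of_Icc (fun i => (i, p.2)) (fun i => by simp [GridAdj])
      fun i h1 h2 => ⟨x, hx, between _ _ _ _ hp.1 hq.1 h1 h2, hp.2⟩
  · exact reflTransGen_of_Icc (fun i => (q.1, i)) (fun i => by simp [GridAdj])
      fun i h1 h2 => ⟨x, hx, hq.1, between _ _ _ _ hp.2 hq.2 h1 h2⟩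

lemma gridNear_connected {K : Set (ℝ × ℝ)} (hK : IsPreconnected K) :
    ∀ p ∈ gridNear K, ∀ q ∈ gridNear K,
      Relation.ReflTransGen (fun x y => GridAdj x y ∧ y ∈ gridNear K) p q := by
  have hround : ∀ x : ℝ × ℝ, |((round x.1 : ℤ) : ℝ) - x.1| ≤ 1 / 2 ∧
      |((round x.2 : ℤ) : ℝ) - x.2| ≤ 1 / 2 := by
    intro x
    rw [abs_sub_comm, abs_sub_comm _ x.2]
    exact ⟨abs_sub_round _, abs_sub_round _⟩
  have hround' : ∀ x : ℝ × ℝ, |((round x.1 : ℤ) : ℝ) - x.1| ≤ 1 ∧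
      |((round x.2 : ℤ) : ℝ) - x.2| ≤ 1 := by
    intro x
    have := hround x
    constructor <;> linarith [this.1, this.2]
  have key : ∀ x ∈ K, ∀ y ∈ K, Relation.ReflTransGen (fun x y => GridAdj x y ∧ y ∈ gridNear K)
      (round x.1, round x.2) (round y.1, round y.2) := by
    intro x hx y hy
    refine hK.induction₂ (fun x y : ℝ × ℝ =>
      Relation.ReflTransGen (fun x y => GridAdj x y ∧ y ∈ gridNear K)
      (round x.1, round x.2) (round y.1, round y.2)) ?_ ?_ ?_ hx hy
    · intro x hx
      have : Metric.ball x (1 / 2) ∩ K ∈ nhdsWithin x K :=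
        Filter.inter_mem (mem_nhdsWithin_of_mem_nhds (Metric.ball_mem_nhds x (by norm_num)))
          self_mem_nhdsWithin
      filter_upwards [this] with y hy
      refine reflTransGen_of_near hy.2 ?_ (hround' y)
      have h1 := hy.1
      rw [Metric.mem_ball, Prod.dist_eq, max_lt_iff, Real.dist_eq, Real.dist_eq] at h1
      have h2 := hround x
      simp only [abs_lt, abs_le] at h1 h2 ⊢
      refine ⟨⟨?_, ?_⟩, ?_, ?_⟩ <;> linarith [h1.1.1, h1.1.2, h1.2.1, h1.2.2]
    · exact fun x y z _ _ _ h1 h2 => h1.trans h2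
    · exact fun x y hx _ h => reflTransGen_symm ⟨x, hx, hround' x⟩ h
  rintro p ⟨x, hx, hp⟩ q ⟨y, hy, hq⟩
  exact ((reflTransGen_of_near hx hp (hround' x)).trans (key x hx y hy)).trans
    (reflTransGen_of_near hy (hround' y) hq)

/-- After magnification disjoint compact sets have disjoint sets of nearby grid points. -/
lemma exists_disjoint_gridNear {ι : Type*} [Finite ι] (S : ι → Set (ℝ × ℝ))
    (hS : ∀ i, IsCompact (S i)) :
    ∃ c : ℝ, ∀ i j, Disjoint (S i) (S j) →
      Disjoint (gridNear ((c • ·) '' S i)) (gridNear ((c • ·) '' S j)) := by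
  have h : ∀ i j, ∀ᶠ c : ℝ in Filter.atTop, Disjoint (S i) (S j) →
      Disjoint (gridNear ((c • ·) '' S i)) (gridNear ((c • ·) '' S j)) := by
    intro i j
    by_cases hd : Disjoint (S i) (S j)
    · obtain ⟨ε, hε, hdist⟩ := hd.exists_thickenings (hS i) (hS j).isClosed
      filter_upwards [Filter.eventually_gt_atTop (2 / ε), Filter.eventually_gt_atTop 0]
        with c hc hc0 _
      rw [div_lt_iff₀ hε] at hc
      rw [Set.disjoint_left]
      rintro p ⟨_, ⟨x, hx, rfl⟩, h1, h2⟩ ⟨_, ⟨y, hy, rfl⟩, h3, h4⟩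
      refine Set.disjoint_left.1 hdist (Metric.self_subset_thickening hε _ hx)
        (Metric.mem_thickening_iff.2 ⟨y, hy, ?_⟩)
      have h5 : dist (c • x) (c • y) ≤ 2 := by
        rw [Prod.dist_eq, Real.dist_eq, Real.dist_eq]
        simp only [abs_le, max_le_iff] at h1 h2 h3 h4 ⊢
        refine ⟨⟨?_, ?_⟩, ?_, ?_⟩ <;>
          linarith [h1.1, h1.2, h2.1, h2.2, h3.1, h3.2, h4.1, h4.2]
      rw [dist_smul₀, Real.norm_of_nonneg hc0.le] at h5
      exact lt_of_mul_lt_mul_left (h5.trans_lt hc) hc0.le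
    · exact Filter.Eventually.of_forall fun _ h => absurd h hd
  exact (Filter.eventually_all.2 fun i => Filter.eventually_all.2 (h i)).exists

end gridNear

section embedding

variable {V : Type u} {G : SimpleGraph V} (E : GraphEmbeddingIn (ℝ × ℝ) G)

/-- The arcs of a drawing, chosen so that reversed darts have reversed arcs; the arc is constant
if there is no edge. -/
noncomputable def symArc (u v : V) (t : ℝ) : ℝ × ℝ :=
  if h : G.Adj u v then
    if WellOrderingRel u v then E.edgeArc u v h t else E.edgeArc v u h.symm (1 - t)
  else E.vertexPos u

lemma symArc_of_not_adj {u v : V} (h : ¬ G.Adj u v) (t : ℝ) : symArc E u v t = E.vertexPos u :=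
  dif_neg h

lemma symArc_cases {u v : V} (h : G.Adj u v) :
    (∃ h', ∀ t, symArc E u v t = E.edgeArc u v h' t) ∨
      ∃ h', ∀ t, symArc E u v t = E.edgeArc v u h' (1 - t) := by
  by_cases hr : WellOrderingRel u v
  · exact Or.inl ⟨h, fun t => by simp [symArc, h, hr]⟩
  · exact Or.inr ⟨h.symm, fun t => by simp [symArc, h, hr]⟩

lemma symArc_reverse {u v : V} (h : G.Adj u v) (t : ℝ) :
    symArc E v u t = symArc E u v (1 - t) := by
  rcases trichotomous_of WellOrderingRel u v with hr | hr | hr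
  · have hr' : ¬ WellOrderingRel v u := fun h' => asymm_of WellOrderingRel hr h'
    simp [symArc, h, h.symm, hr, hr']
  · exact absurd hr h.ne
  · have hr' : ¬ WellOrderingRel u v := fun h' => asymm_of WellOrderingRel hr h'
    simp [symArc, h, h.symm, hr, hr']

lemma symArc_zero (u v : V) : symArc E u v 0 = E.vertexPos u := by
  by_cases h : G.Adj u v
  · rcases symArc_cases E h with ⟨h', ht⟩ | ⟨h', ht⟩
    · rw [ht, E.arc_start]
    · rw [ht, sub_zero, E.arc_end]
  · exact symArc_of_not_adj E h 0

lemma one_sub_mem_Icc {t : ℝ} (ht : t ∈ Set.Icc (0 : ℝ) 1) : 1 - t ∈ Set.Icc (0 : ℝ) 1 :=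
  ⟨by linarith [ht.2], by linarith [ht.1]⟩

lemma one_sub_mem_Ioo {t : ℝ} (ht : t ∈ Set.Ioo (0 : ℝ) 1) : 1 - t ∈ Set.Ioo (0 : ℝ) 1 :=
  ⟨by linarith [ht.2], by linarith [ht.1]⟩

lemma continuousOn_symArc (u v : V) : ContinuousOn (symArc E u v) (Set.Icc 0 1) := by
  by_cases h : G.Adj u v
  · rcases symArc_cases E h with ⟨h', ht⟩ | ⟨h', ht⟩
    · rw [funext ht]
      exact E.arc_cont u v h'
    · rw [funext ht]
      exact (E.arc_cont v u h').comp (by fun_prop) fun t ht => one_sub_mem_Icc ht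
  · rw [funext (symArc_of_not_adj E h)]
    exact continuousOn_const

lemma injOn_symArc {u v : V} (h : G.Adj u v) : Set.InjOn (symArc E u v) (Set.Icc 0 1) := by
  rcases symArc_cases E h with ⟨h', ht⟩ | ⟨h', ht⟩
  · rw [funext ht]
    exact E.arc_injOn u v h'
  · intro s hs t ht' he
    rw [ht, ht] at he
    linarith [E.arc_injOn v u h' (one_sub_mem_Icc hs) (one_sub_mem_Icc ht') he]

lemma symArc_ne_vertexPos {u v : V} (h : G.Adj u v) {t : ℝ} (ht : t ∈ Set.Ioo (0 : ℝ) 1) (w : V) :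
    symArc E u v t ≠ E.vertexPos w := by
  intro he
  rcases symArc_cases E h with ⟨h', hs⟩ | ⟨h', hs⟩ <;> rw [hs] at he
  · exact E.arc_avoid u v h' w ⟨t, ht, he⟩
  · exact E.arc_avoid v u h' w ⟨1 - t, one_sub_mem_Ioo ht, he⟩

lemma symArc_ne_symArc {u v u' v' : V} (h : G.Adj u v) (h' : G.Adj u' v')
    (hne : s(u, v) ≠ s(u', v')) {s t : ℝ} (hs : s ∈ Set.Ioo (0 : ℝ) 1)
    (ht : t ∈ Set.Icc (0 : ℝ) 1) : symArc E u v s ≠ symArc E u' v' t := by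
  intro he
  have key : ∀ a b c d (h₁ : G.Adj a b) (h₂ : G.Adj c d), s(a, b) ≠ s(c, d) →
      ∀ x ∈ Set.Ioo (0 : ℝ) 1, ∀ y ∈ Set.Icc (0 : ℝ) 1,
      E.edgeArc a b h₁ x ≠ E.edgeArc c d h₂ y := by
    intro a b c d h₁ h₂ hne x hx y hy hxy
    have := E.arc_disjoint a b h₁ c d h₂ hne
    exact Set.eq_empty_iff_forall_notMem.1 this _ ⟨⟨x, hx, rfl⟩, ⟨y, hy, hxy.symm⟩⟩
  have hs' := one_sub_mem_Ioo hs
  have ht' := one_sub_mem_Icc ht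
  rcases symArc_cases E h with ⟨g, hg⟩ | ⟨g, hg⟩ <;>
    rcases symArc_cases E h' with ⟨g', hg'⟩ | ⟨g', hg'⟩ <;> rw [hg, hg'] at he
  · exact key _ _ _ _ g g' hne _ hs _ ht he
  · exact key _ _ _ _ g g' (by rwa [Sym2.eq_swap (a := v')]) _ hs _ ht' he
  · exact key _ _ _ _ g g' (by rwa [Sym2.eq_swap (a := v)]) _ hs' _ ht he
  · exact key _ _ _ _ g g' (by rwa [Sym2.eq_swap (a := v), Sym2.eq_swap (a := v')]) _ hs' _ ht' he

/-- The union of the initial thirds of the arcs at a vertex. -/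
def star (u : V) : Set (ℝ × ℝ) :=
  ⋃ v, symArc E u v '' Set.Icc 0 (1 / 3)

/-- The middle third of an arc. -/
def middle (u v : V) : Set (ℝ × ℝ) :=
  symArc E u v '' Set.Icc (1 / 3) (2 / 3)

lemma isCompact_star [Finite V] (u : V) : IsCompact (star E u) :=
  isCompact_iUnion fun v => isCompact_Icc.image_of_continuousOn
    ((continuousOn_symArc E u v).mono (Set.Icc_subset_Icc le_rfl (by norm_num)))

lemma isCompact_middle (u v : V) : IsCompact (middle E u v) :=
  isCompact_Icc.image_of_continuousOn
    ((continuousOn_symArc E u v).mono (Set.Icc_subset_Icc (by norm_num) (by norm_num)))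

lemma isPreconnected_star (u : V) : IsPreconnected (star E u) :=
  isPreconnected_iUnion ⟨E.vertexPos u, Set.mem_iInter.2 fun v =>
    ⟨0, by norm_num, symArc_zero E u v⟩⟩ fun v => isPreconnected_Icc.image _
    ((continuousOn_symArc E u v).mono (Set.Icc_subset_Icc le_rfl (by norm_num)))

lemma isPreconnected_middle (u v : V) : IsPreconnected (middle E u v) :=
  isPreconnected_Icc.image _
    ((continuousOn_symArc E u v).mono (Set.Icc_subset_Icc (by norm_num) (by norm_num)))

lemma mem_star {u : V} {x : ℝ × ℝ} (hx : x ∈ star E u) : x = E.vertexPos u ∨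
    ∃ v, G.Adj u v ∧ ∃ t, 0 < t ∧ t ≤ 1 / 3 ∧ x = symArc E u v t := by
  obtain ⟨v, t, ht, rfl⟩ := Set.mem_iUnion.1 hx
  by_cases h : G.Adj u v
  · rcases ht.1.eq_or_lt with rfl | h0
    · exact Or.inl (symArc_zero E u v)
    · exact Or.inr ⟨v, h, t, h0, ht.2, rfl⟩
  · exact Or.inl (symArc_of_not_adj E h t)

lemma disjoint_star {u v : V} (h : u ≠ v) : Disjoint (star E u) (star E v) := by
  rw [Set.disjoint_left]
  intro x hu hv
  rcases mem_star E hu with rfl | ⟨a, ha, s, hs0, hs, rfl⟩ <;>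
    rcases mem_star E hv with he | ⟨b, hb, t, ht0, ht, he⟩
  · exact h (E.vertexInj he)
  · exact symArc_ne_vertexPos E hb ⟨ht0, by linarith⟩ u he.symm
  · exact symArc_ne_vertexPos E ha ⟨hs0, by linarith⟩ v he
  · by_cases hne : s(u, a) = s(v, b)
    · rcases Sym2.eq_iff.1 hne with ⟨h1, _⟩ | ⟨rfl, rfl⟩
      · exact h h1
      · rw [symArc_reverse E ha] at he
        have := injOn_symArc E ha (x₁ := s) (x₂ := 1 - t) ⟨hs0.le, by linarith⟩
          ⟨by linarith, by linarith⟩ he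
        linarith
    · exact symArc_ne_symArc E ha hb hne ⟨hs0, by linarith⟩ ⟨ht0.le, by linarith⟩ he

lemma disjoint_middle_star {u v w : V} (h : G.Adj u v) (hu : w ≠ u) (hv : w ≠ v) :
    Disjoint (middle E u v) (star E w) := by
  rw [Set.disjoint_left]
  rintro _ ⟨s, ⟨hs0, hs1⟩, rfl⟩ hw
  rcases mem_star E hw with he | ⟨b, hb, t, ht0, ht, he⟩
  · exact symArc_ne_vertexPos E h ⟨by linarith, by linarith⟩ w he
  · refine symArc_ne_symArc E h hb (fun hne => ?_) ⟨by linarith, by linarith⟩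
      ⟨ht0.le, by linarith⟩ he
    rcases Sym2.eq_iff.1 hne with ⟨h1, _⟩ | ⟨_, h1⟩
    exacts [hu h1.symm, hv h1.symm]

lemma disjoint_middle {u v u' v' : V} (h : G.Adj u v) (h' : G.Adj u' v')
    (hne : s(u, v) ≠ s(u', v')) : Disjoint (middle E u v) (middle E u' v') := by
  rw [Set.disjoint_left]
  rintro _ ⟨s, ⟨hs0, hs1⟩, rfl⟩ ⟨t, ⟨ht0, ht1⟩, he⟩
  exact symArc_ne_symArc E h h' hne ⟨by linarith, by linarith⟩ ⟨by linarith, by linarith⟩ he.symm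

lemma mem_gridNear_of_mem {K : Set (ℝ × ℝ)} {x : ℝ × ℝ} (hx : x ∈ K) :
    (round x.1, round x.2) ∈ gridNear K := by
  refine ⟨x, hx, ?_⟩
  rw [abs_sub_comm, abs_sub_comm _ x.2]
  constructor <;> linarith [abs_sub_round x.1, abs_sub_round x.2]

include E in
/-- A graph drawn in the plane is planar in the sense of Mac Lane. -/
lemma macLanePlanar_of_embedding [Fintype V] : MacLanePlanar G := by
  let S : V ⊕ V × V → Set (ℝ × ℝ) := Sum.elim (star E) fun e => middle E e.1 e.2
  have hS : ∀ i, IsCompact (S i) := by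
    rintro (u | e)
    exacts [isCompact_star E u, isCompact_middle E e.1 e.2]
  have hSc : ∀ i, IsPreconnected (S i) := by
    rintro (u | e)
    exacts [isPreconnected_star E u, isPreconnected_middle E e.1 e.2]
  obtain ⟨c, hc⟩ := exists_disjoint_gridNear S hS
  have hcont : Continuous fun x : ℝ × ℝ => c • x := continuous_const_smul c
  have hfin : ∀ i, (gridNear ((c • ·) '' S i)).Finite := fun i =>
    gridNear_finite ((hS i).image hcont).isBounded
  have hconn : ∀ i, ∀ p ∈ (hfin i).toFinset, ∀ q ∈ (hfin i).toFinset,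
      Relation.ReflTransGen (fun x y => GridAdj x y ∧ y ∈ (hfin i).toFinset) p q := by
    intro i
    simp only [Set.Finite.mem_toFinset]
    exact gridNear_connected ((hSc i).image _ hcont.continuousOn)
  have hdisj : ∀ i j p, Disjoint (S i) (S j) → p ∈ (hfin i).toFinset →
      p ∉ (hfin j).toFinset := by
    intro i j p hd
    simp only [Set.Finite.mem_toFinset]
    exact fun h => Set.disjoint_left.1 (hc i j hd) h
  have hmeet : ∀ i j x, x ∈ S i → x ∈ S j → ∃ p ∈ (hfin i).toFinset, p ∈ (hfin j).toFinset := by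
    intro i j x hi hj
    simp only [Set.Finite.mem_toFinset]
    exact ⟨_, mem_gridNear_of_mem (Set.mem_image_of_mem _ hi),
      mem_gridNear_of_mem (Set.mem_image_of_mem _ hj)⟩
  obtain ⟨B, hB⟩ := exists_isGridModel (G := G) (r := fun u v => G.Adj u v ∧ WellOrderingRel u v)
    (fun u v h => by
      rcases trichotomous_of WellOrderingRel u v with hr | hr | hr
      exacts [Or.inl ⟨h, hr⟩, absurd hr h.ne, Or.inr ⟨h.symm, hr⟩])
    (fun u v h => h.1.ne) (fun u => (hfin (.inl u)).toFinset)
    (fun u v => (hfin (.inr (u, v))).toFinset) (fun u => hconn _) (fun u v _ => hconn _)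
    (fun p u v hu hv => by
      by_contra hne
      exact hdisj (.inl u) (.inl v) p (disjoint_star E hne) hu hv)
    (fun p u v w huv hp hw => by
      by_contra! hne
      exact hdisj (.inr (u, v)) (.inl w) p (disjoint_middle_star E huv.1 hne.1 hne.2) hp hw)
    (fun p u v u' v' h h' hp hp' => by
      by_contra hne
      refine hdisj (.inr (u, v)) (.inr (u', v')) p
        (disjoint_middle E h.1 h'.1 fun he => ?_) hp hp'
      rcases Sym2.eq_iff.1 he with ⟨h1, _⟩ | ⟨rfl, rfl⟩
      exacts [hne h1, asymm_of WellOrderingRel h.2 h'.2])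
    (fun u v h => hmeet (.inr (u, v)) (.inl u) (symArc E u v (1 / 3))
      ⟨_, by norm_num, rfl⟩ (Set.mem_iUnion.2 ⟨v, _, by norm_num, rfl⟩))
    (fun u v h => hmeet (.inr (u, v)) (.inl v) (symArc E u v (2 / 3))
      ⟨_, by norm_num, rfl⟩ (Set.mem_iUnion.2 ⟨u, 1 / 3, by norm_num, by
        rw [symArc_reverse E h.1]; norm_num⟩))
  exact hB.macLanePlanar

end embedding

section subdivision

variable {V : Type u}

/-- Replace the edge `x y` by a path of length two through a new vertex. -/
def subdivide (G : SimpleGraph V) (x y : V) : SimpleGraph (Option V) where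
  Adj
    | some u, some v => G.Adj u v ∧ s(u, v) ≠ s(x, y)
    | some u, none => u = x ∨ u = y
    | none, some u => u = x ∨ u = y
    | none, none => False
  symm := ⟨by
    rintro (_ | u) (_ | v) h
    · exact h
    · exact h
    · exact h
    · exact ⟨h.1.symm, by rw [Sym2.eq_swap]; exact h.2⟩⟩
  loopless := ⟨by
    rintro (_ | u) h
    · exact h
    · exact G.irrefl h.1⟩

lemma subdivide_adj_some {G : SimpleGraph V} {x y u v : V} :
    (subdivide G x y).Adj (some u) (some v) ↔ G.Adj u v ∧ s(u, v) ≠ s(x, y) := Iff.rfl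

lemma subdivide_adj_none {G : SimpleGraph V} {x y u : V} :
    (subdivide G x y).Adj (some u) none ↔ u = x ∨ u = y := Iff.rfl

lemma subdivide_none_adj {G : SimpleGraph V} {x y u : V} :
    (subdivide G x y).Adj none (some u) ↔ u = x ∨ u = y := Iff.rfl

/-- The face on the left of a dart after a subdivision. -/
noncomputable def subdivideFace {Φ : Type} (l : V → V → Φ) (x y : V) : Option V → Option V → Φ
  | some u, some v => l u v
  | some u, none => if u = x then l x y else l y x
  | none, some u => if u = x then l y x else l x y
  | none, none => l x y

section

variable {Φ : Type} {G : SimpleGraph V} {l : V → V → Φ} {x y : V}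

lemma faceBoundary_subdivide_some (hxy : G.Adj x y) (w : Φ → ZMod 2) (u v : V) :
    faceBoundary (subdivide G x y) (subdivideFace l x y) w (some u) (some v) =
      faceBoundary G l w u v + edgeChain x y u v * faceBoundary G l w x y := by
  by_cases h : s(u, v) = s(x, y)
  · rw [faceBoundary_of_not_adj _ _ fun h' => (subdivide_adj_some.1 h').2 h, edgeChain, if_pos h,
      one_mul]
    rcases Sym2.eq_iff.1 h with ⟨rfl, rfl⟩ | ⟨rfl, rfl⟩
    · exact (CharTwo.add_self_eq_zero _).symm
    · rw [faceBoundary_symm, CharTwo.add_self_eq_zero]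
  · rw [edgeChain, if_neg h, zero_mul, add_zero]
    by_cases huv : G.Adj u v
    · rw [faceBoundary_of_adj _ _ huv, faceBoundary_of_adj _ _ (subdivide_adj_some.2 ⟨huv, h⟩)]
      rfl
    · rw [faceBoundary_of_not_adj _ _ huv,
        faceBoundary_of_not_adj _ _ fun h' => huv (subdivide_adj_some.1 h').1]

lemma faceBoundary_subdivide_none (hxy : G.Adj x y) (w : Φ → ZMod 2) (u : V) :
    faceBoundary (subdivide G x y) (subdivideFace l x y) w (some u) none =
      ((if u = x then 1 else 0) + if u = y then 1 else 0) * faceBoundary G l w x y := by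
  by_cases hx : u = x
  · subst hx
    rw [faceBoundary_of_adj _ _ (subdivide_adj_none.2 (Or.inl rfl)), faceBoundary_of_adj _ _ hxy,
      if_pos rfl, if_neg hxy.ne, add_zero, one_mul]
    simp [subdivideFace]
  · by_cases hy : u = y
    · subst hy
      rw [faceBoundary_of_adj _ _ (subdivide_adj_none.2 (Or.inr rfl)), faceBoundary_of_adj _ _ hxy,
        if_pos rfl, if_neg hx, zero_add, one_mul]
      simp [subdivideFace, hx, add_comm]
    · rw [faceBoundary_of_not_adj _ _ fun h => (subdivide_adj_none.1 h).elim hx hy, if_neg hx,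
        if_neg hy, zero_add, zero_mul]

lemma IsFacial.subdivide [Fintype V] (hl : IsFacial G l) (hxy : G.Adj x y) :
    IsFacial (subdivide G x y) (subdivideFace l x y) where
  sum_faceBoundary w := by
    rintro (_ | u)
    · rw [Fintype.sum_option, faceBoundary_of_not_adj _ _ (SimpleGraph.irrefl _), zero_add]
      simp only [faceBoundary_symm _ _ _ none, faceBoundary_subdivide_none hxy, ← sum_mul]
      rw [sum_add_distrib]
      simp [CharTwo.add_self_eq_zero]
    · simp only [Fintype.sum_option, faceBoundary_subdivide_none hxy,
        faceBoundary_subdivide_some hxy, sum_add_distrib, hl.sum_faceBoundary, ← sum_mul,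
        sum_edgeChain hxy.ne]
      rw [zero_add, CharTwo.add_self_eq_zero]
  exists_eq z hz := by
    have hnone : ∀ u, z (some u) none =
        ((if u = x then 1 else 0) + if u = y then 1 else 0) * z (some x) none := by
      intro u
      by_cases hx : u = x
      · rw [hx, if_pos rfl, if_neg hxy.ne, add_zero, one_mul]
      · by_cases hy : u = y
        · subst hy
          rw [if_pos rfl, if_neg hx, zero_add, one_mul]
          have h0 := hz.sum_eq_zero none
          rw [Fintype.sum_option, hz.eq_zero _ _ (SimpleGraph.irrefl _), zero_add,
            ← sum_subset (subset_univ {x, u}), sum_pair hxy.ne, CharTwo.add_eq_zero] at h0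
          · rw [hz.symm, ← h0, hz.symm]
          · intro v _ hv
            refine hz.eq_zero _ _ fun h => hv ?_
            rw [mem_insert, mem_singleton]
            exact subdivide_none_adj.1 h
        · rw [hz.eq_zero _ _ fun h => (subdivide_adj_none.1 h).elim hx hy, if_neg hx, if_neg hy,
            zero_add, zero_mul]
    obtain ⟨w, hw⟩ := hl.exists_eq
      (fun u v => z (some u) (some v) + edgeChain x y u v * z (some x) none)
      ⟨fun u v => by rw [hz.symm, edgeChain_symm], fun u v h => by
        rw [hz.eq_zero _ _ fun h' => h (subdivide_adj_some.1 h').1, edgeChain, if_neg, zero_mul,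
          add_zero]
        intro he
        rw [← SimpleGraph.mem_edgeSet, he, SimpleGraph.mem_edgeSet] at h
        exact h hxy, fun u => by
        rw [sum_add_distrib, ← sum_mul, sum_edgeChain hxy.ne, ← hnone, add_comm,
          ← Fintype.sum_option, hz.sum_eq_zero]⟩
    have hw' : ∀ u v, z (some u) (some v) + edgeChain x y u v * z (some x) none =
        faceBoundary G l w u v := fun u v => congrFun (congrFun hw u) v
    have hβ : z (some x) none = faceBoundary G l w x y := by
      rw [← hw' x y, hz.eq_zero _ _ fun h => (subdivide_adj_some.1 h).2 rfl, edgeChain, if_pos rfl,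
        one_mul, zero_add]
    have h1 : ∀ u, z (some u) none =
        faceBoundary (ThreeColoring.subdivide G x y) (subdivideFace l x y) w (some u) none := by
      intro u
      rw [faceBoundary_subdivide_none hxy, hnone, hβ]
    refine ⟨w, ?_⟩
    ext1 u; ext1 v
    rcases u with _ | u <;> rcases v with _ | v
    · rw [hz.eq_zero _ _ (SimpleGraph.irrefl _), faceBoundary_of_not_adj _ _ (SimpleGraph.irrefl _)]
    · rw [hz.symm, faceBoundary_symm, h1]
    · exact h1 u
    · rw [faceBoundary_subdivide_some hxy, ← hw', ← hβ, add_assoc, CharTwo.add_self_eq_zero,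
        add_zero]

end

lemma subdivide_triangleFree {G : SimpleGraph V} {x y : V}
    (htf : ∀ x y z, G.Adj x y → G.Adj y z → ¬ G.Adj x z) :
    ∀ a b c, (subdivide G x y).Adj a b → (subdivide G x y).Adj b c →
      ¬ (subdivide G x y).Adj a c := by
  have key : ∀ u v, (subdivide G x y).Adj (some u) none → (subdivide G x y).Adj (some v) none →
      ¬ (subdivide G x y).Adj (some u) (some v) := by
    intro u v hu hv huv
    rcases subdivide_adj_none.1 hu with rfl | rfl <;>
      rcases subdivide_adj_none.1 hv with rfl | rfl
    · exact SimpleGraph.irrefl _ huv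
    · exact (subdivide_adj_some.1 huv).2 rfl
    · exact (subdivide_adj_some.1 huv).2 Sym2.eq_swap
    · exact SimpleGraph.irrefl _ huv
  rintro (_ | a) (_ | b) (_ | c) h1 h2 h3
  · exact h1
  · exact h1
  · exact h3
  · exact key _ _ h1.symm h3.symm h2
  · exact h2
  · exact key _ _ h1 h2.symm h3
  · exact key _ _ h3 h2 h1
  · exact htf _ _ _ h1.1 h2.1 h3.1

end subdivision

section precoloring

variable {V : Type u} [Fintype V] {G : SimpleGraph V}

lemma exists_avoiding (hG : MacLanePlanar G) (htf : ∀ x y z, G.Adj x y → G.Adj y z → ¬ G.Adj x z)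
    (a b c d : V) : ∃ φ : V → Fin 3, (∀ u v, G.Adj u v → φ u ≠ φ v) ∧
      φ a ≠ 2 ∧ φ b ≠ 2 ∧ φ c ≠ 2 ∧ φ d ≠ 2 := by
  obtain ⟨φ, h1, h2⟩ := MacLanePlanar.avoidingColorable _ G {a, b, c, d} hG htf card_le_four le_rfl
  exact ⟨φ, h1, h2 _ (by simp), h2 _ (by simp), h2 _ (by simp), h2 _ (by simp)⟩

lemma exists_perm {x y x' y' : Fin 3} (h : x ≠ y) (h' : x' ≠ y') :
    ∃ σ : Equiv.Perm (Fin 3), σ x = x' ∧ σ y = y' := by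
  refine ⟨(Equiv.swap (Equiv.swap x x' y) y') * Equiv.swap x x', ?_⟩
  revert x y x' y'
  decide

lemma eq_of_ne_of_ne {x y z t : Fin 3} (h : x ≠ y) (hx : z ≠ x) (hy : z ≠ y) (hx' : t ≠ x)
    (hy' : t ≠ y) : z = t := by
  revert x y z t
  decide

lemma exists_coloring_of_pentagon (hG : MacLanePlanar G)
    (htf : ∀ x y z, G.Adj x y → G.Adj y z → ¬ G.Adj x z) {a b c d e : V} (hab : G.Adj a b)
    (hbc : G.Adj b c) (hcd : G.Adj c d) (hde : G.Adj d e) (hea : G.Adj e a) {f : V → Fin 3}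
    (fab : f a ≠ f b) (fbc : f b ≠ f c) (fcd : f c ≠ f d) (fde : f d ≠ f e) (fea : f e ≠ f a) :
    ∃ φ : V → Fin 3, (∀ u v, G.Adj u v → φ u ≠ φ v) ∧
      φ a = f a ∧ φ b = f b ∧ φ c = f c ∧ φ d = f d ∧ φ e = f e := by
  have key : ∀ a b c d e, G.Adj a b → G.Adj b c → G.Adj c d → G.Adj d e → G.Adj e a →
      f a ≠ f b → f d ≠ f e → f e ≠ f a → f a = f c → f b = f d →
      ∃ φ : V → Fin 3, (∀ u v, G.Adj u v → φ u ≠ φ v) ∧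
        φ a = f a ∧ φ b = f b ∧ φ c = f c ∧ φ d = f d ∧ φ e = f e := by
    intro a b c d e hab hbc hcd hde hea fab fde fea fac fbd
    obtain ⟨φ, hφ, ha, hb, hc, hd⟩ := exists_avoiding hG htf a b c d
    obtain ⟨σ, h1, h2⟩ := exists_perm (hφ a b hab) fab
    have e1 : φ c = φ a := eq_of_ne_of_ne hb (hφ b c hbc).symm hc (hφ a b hab) ha
    have e2 : φ d = φ b := eq_of_ne_of_ne hc (hφ c d hcd).symm hd (hφ b c hbc) hb
    refine ⟨fun v => σ (φ v), fun u v huv he => hφ u v huv (σ.injective he), h1, h2, ?_, ?_, ?_⟩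
    · simp only [e1, h1, fac]
    · simp only [e2, h2, fbd]
    · refine eq_of_ne_of_ne fab ?_ ?_ fea (fbd ▸ fde.symm)
      · rw [← h1]
        exact fun he => hφ _ _ hea (σ.injective he)
      · rw [← h2, ← e2]
        exact fun he => hφ _ _ hde (σ.injective he).symm
  have hcases : ∀ x₁ x₂ x₃ x₄ x₅ : Fin 3, x₁ ≠ x₂ → x₂ ≠ x₃ → x₃ ≠ x₄ → x₄ ≠ x₅ → x₅ ≠ x₁ →
      x₁ = x₃ ∧ x₂ = x₄ ∨ x₂ = x₄ ∧ x₃ = x₅ ∨ x₃ = x₅ ∧ x₄ = x₁ ∨ x₄ = x₁ ∧ x₅ = x₂ ∨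
        x₅ = x₂ ∧ x₁ = x₃ := by decide
  rcases hcases _ _ _ _ _ fab fbc fcd fde fea with ⟨h, h'⟩ | ⟨h, h'⟩ | ⟨h, h'⟩ | ⟨h, h'⟩ | ⟨h, h'⟩
  · exact key a b c d e hab hbc hcd hde hea fab fde fea h h'
  · obtain ⟨φ, hφ, hφ'⟩ := key b c d e a hbc hcd hde hea hab fbc fea fab h h'
    exact ⟨φ, hφ, by tauto⟩
  · obtain ⟨φ, hφ, hφ'⟩ := key c d e a b hcd hde hea hab hbc fcd fab fbc h h'
    exact ⟨φ, hφ, by tauto⟩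
  · obtain ⟨φ, hφ, hφ'⟩ := key d e a b c hde hea hab hbc hcd fde fbc fcd h h'
    exact ⟨φ, hφ, by tauto⟩
  · obtain ⟨φ, hφ, hφ'⟩ := key e a b c d hea hab hbc hcd hde fea fcd fde h h'
    exact ⟨φ, hφ, by tauto⟩

/-- A coloring in which one diagonal of a given `4`-cycle is monochromatic and the other is not. -/
lemma exists_coloring_diagonal (hG : MacLanePlanar G)
    (htf : ∀ x y z, G.Adj x y → G.Adj y z → ¬ G.Adj x z) {a b c d : V} (hab : G.Adj a b)
    (hbc : G.Adj b c) (hcd : G.Adj c d) (hda : G.Adj d a) (hac : a ≠ c) (hbd : b ≠ d) :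
    ∃ φ : V → Fin 3, (∀ u v, G.Adj u v → φ u ≠ φ v) ∧ φ a = φ c ∧ φ b ≠ φ d := by
  obtain ⟨Φ, l, hl⟩ := hG
  obtain ⟨φ, hφ, ha, hb, hc, hn⟩ := exists_avoiding ⟨Φ, _, hl.subdivide hcd⟩
    (subdivide_triangleFree htf) (some a) (some b) (some c) none
  have h1 := hφ (some a) (some b) (subdivide_adj_some.2 ⟨hab, by
    rw [Ne, Sym2.eq_iff]; have := hbc.ne; tauto⟩)
  have h2 := hφ (some b) (some c) (subdivide_adj_some.2 ⟨hbc, by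
    rw [Ne, Sym2.eq_iff]; have := hbc.ne; tauto⟩)
  have h3 := hφ (some d) (some a) (subdivide_adj_some.2 ⟨hda, by
    rw [Ne, Sym2.eq_iff]; have := hcd.ne; tauto⟩)
  have h4 := hφ (some c) none (subdivide_adj_none.2 (Or.inl rfl))
  have h5 := hφ (some d) none (subdivide_adj_none.2 (Or.inr rfl))
  have e1 : φ (some c) = φ (some a) := eq_of_ne_of_ne hb h2.symm hc h1 ha
  have e2 : φ none = φ (some b) := eq_of_ne_of_ne hc h4.symm hn h2 hb
  refine ⟨fun v => φ (some v), fun u v huv => ?_, e1.symm, fun he => h5 (he.symm.trans e2.symm)⟩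
  by_cases he : s(u, v) = s(c, d)
  · rcases Sym2.eq_iff.1 he with ⟨rfl, rfl⟩ | ⟨rfl, rfl⟩
    · exact fun he' => h3 (he'.symm.trans e1)
    · exact fun he' => h3 (he'.trans e1)
  · exact hφ _ _ (subdivide_adj_some.2 ⟨huv, he⟩)

lemma exists_coloring_of_square (hG : MacLanePlanar G)
    (htf : ∀ x y z, G.Adj x y → G.Adj y z → ¬ G.Adj x z) {a b c d : V} (hab : G.Adj a b)
    (hbc : G.Adj b c) (hcd : G.Adj c d) (hda : G.Adj d a) (hac : a ≠ c) (hbd : b ≠ d)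
    {f : V → Fin 3} (fab : f a ≠ f b) (fbc : f b ≠ f c) (fcd : f c ≠ f d) (fda : f d ≠ f a) :
    ∃ φ : V → Fin 3, (∀ u v, G.Adj u v → φ u ≠ φ v) ∧
      φ a = f a ∧ φ b = f b ∧ φ c = f c ∧ φ d = f d := by
  have key : ∀ a b c d, G.Adj a b → G.Adj b c → G.Adj c d → G.Adj d a → a ≠ c → b ≠ d →
      f a ≠ f b → f b ≠ f c → f c ≠ f d → f d ≠ f a → f b ≠ f d →
      ∃ φ : V → Fin 3, (∀ u v, G.Adj u v → φ u ≠ φ v) ∧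
        φ a = f a ∧ φ b = f b ∧ φ c = f c ∧ φ d = f d := by
    intro a b c d hab hbc hcd hda hac hbd fab fbc fcd fda fbd
    obtain ⟨φ, hφ, e, hne⟩ := exists_coloring_diagonal hG htf hab hbc hcd hda hac hbd
    obtain ⟨σ, h1, h2⟩ := exists_perm (hφ a b hab) fab
    have e' : f a = f c := eq_of_ne_of_ne fbd fab fda.symm fbc.symm fcd
    refine ⟨fun v => σ (φ v), fun u v huv he => hφ u v huv (σ.injective he), h1, h2, ?_, ?_⟩
    · simp only [← e, h1, e']
    · refine eq_of_ne_of_ne fab ?_ ?_ fda fbd.symm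
      · rw [← h1]
        exact fun he => hφ _ _ hda (σ.injective he)
      · rw [← h2]
        exact fun he => hne (σ.injective he).symm
  by_cases fbd : f b = f d
  · by_cases fac : f a = f c
    · obtain ⟨φ, hφ, ha, hb, hc, hd⟩ := exists_avoiding hG htf a b c d
      obtain ⟨σ, h1, h2⟩ := exists_perm (hφ a b hab) fab
      have e1 : φ c = φ a := eq_of_ne_of_ne hb (hφ b c hbc).symm hc (hφ a b hab) ha
      have e2 : φ d = φ b := eq_of_ne_of_ne hc (hφ c d hcd).symm hd (hφ b c hbc) hb
      refine ⟨fun v => σ (φ v), fun u v huv he => hφ u v huv (σ.injective he), h1, h2, ?_, ?_⟩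
      · simp only [e1, h1, fac]
      · simp only [e2, h2, fbd]
    · obtain ⟨φ, hφ, hφ'⟩ := key b c d a hbc hcd hda hab hbd hac.symm fbc fcd fda fab (Ne.symm fac)
      exact ⟨φ, hφ, by tauto⟩
  · exact key a b c d hab hbc hcd hda hac hbd fab fbc fcd fda fbd

end precoloring

end ThreeColoring

/-- Every proper 3-coloring of the boundary cycle (of length at most 5) of a face of a plane
triangle-free graph extends to a proper 3-coloring of the whole graph. -/
theorem face_precoloring_extends [Fintype V] (G : SimpleGraph V) (htf : G.CliqueFree 3)
    (E : GraphEmbeddingIn (ℝ × ℝ) G) (F : Set (ℝ × ℝ)) (hF : E.IsFace F)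
    (v : V) (W : G.Walk v v) (hW : W.IsCycle) (hlen : W.length ≤ 5)
    (hbd : frontier F = E.walkDrawing W)
    (c : V → Fin 3) (hc : ∀ d ∈ W.darts, c d.toProd.1 ≠ c d.toProd.2) :
    ∃ φ : G.Coloring (Fin 3), ∀ x ∈ W.support, φ x = c x := by
  classical
  have htf' : ∀ x y z, G.Adj x y → G.Adj y z → ¬ G.Adj x z := fun x y z hxy hyz hxz =>
    htf {x, y, z} (SimpleGraph.is3Clique_triple_iff.2 ⟨hxy, hxz, hyz⟩)
  have hG := ThreeColoring.macLanePlanar_of_embedding E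
  suffices h : ∃ φ : V → Fin 3, (∀ u v, G.Adj u v → φ u ≠ φ v) ∧ ∀ x ∈ W.support, φ x = c x by
    obtain ⟨φ, h1, h2⟩ := h
    exact ⟨SimpleGraph.Coloring.mk φ fun {u v} => h1 u v, h2⟩
  have h3 := hW.three_le_length
  have hnd := hW.support_nodup
  clear hbd hW
  rcases W with _ | ⟨h₁, W⟩
  · simp at h3
  rcases W with _ | ⟨h₂, W⟩
  · simp at h3
  rcases W with _ | ⟨h₃, W⟩
  · simp at h3
  rcases W with _ | ⟨h₄, W⟩
  · exact absurd h₃.symm (htf' _ _ _ h₁ h₂)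
  rcases W with _ | ⟨h₅, W⟩
  · simp only [SimpleGraph.Walk.darts_cons, SimpleGraph.Walk.darts_nil, List.forall_mem_cons,
      List.not_mem_nil, false_imp_iff, implies_true, and_true] at hc
    simp only [SimpleGraph.Walk.support_cons, SimpleGraph.Walk.support_nil, List.tail_cons,
      List.nodup_cons, List.mem_cons, List.not_mem_nil, or_false, not_or] at hnd
    obtain ⟨c₁, c₂, c₃, c₄⟩ := hc
    obtain ⟨φ, hφ, e₁, e₂, e₃, e₄⟩ := ThreeColoring.exists_coloring_of_square hG htf' h₁ h₂ h₃ h₄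
      (Ne.symm hnd.2.1.2) hnd.1.2.1 c₁ c₂ c₃ c₄
    refine ⟨φ, hφ, ?_⟩
    simp [e₁, e₂, e₃, e₄]
  rcases W with _ | ⟨h₆, W⟩
  · simp only [SimpleGraph.Walk.darts_cons, SimpleGraph.Walk.darts_nil, List.forall_mem_cons,
      List.not_mem_nil, false_imp_iff, implies_true, and_true] at hc
    obtain ⟨c₁, c₂, c₃, c₄, c₅⟩ := hc
    obtain ⟨φ, hφ, e₁, e₂, e₃, e₄, e₅⟩ :=
      ThreeColoring.exists_coloring_of_pentagon hG htf' h₁ h₂ h₃ h₄ h₅ c₁ c₂ c₃ c₄ c₅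
    refine ⟨φ, hφ, ?_⟩
    simp [e₁, e₂, e₃, e₄, e₅]
  · simp only [SimpleGraph.Walk.length_cons] at hlen
    omega
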